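/- arXiv:2110.01149 — 6 statements merged into one kernel-verified Lean document; each statement's English description precedes it below -/
import Mathlib

section
/- With X, μ and f_{j,M} as in the context, for all j, M ∈ ℤ₊, all N ∈ ℕ with N ≤ M, and all W ∈ ℕ with W ≤ j + N, one has sup_{Ī ∈ 𝔖_∞(ℕ)} μ({x ∈ X : N_{2^{-N}, Ī} f_{j,M}(x) ≥ 2^W}) ≤ 2^{M+j+2+N−W} + (N+1)·2^M + (M+1)·2^M·𝟙{W = 0}. -/
open MeasureTheory ENNReal

instance : MeasurableSpace ℕ+ := ⊤

/-- The measure space `X = {(2^k, n) : k ∈ ℕ, n ∈ ℤ₊}` with `μ({(2^k,n)}) = 2^k`,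
parametrized by the pairs `(k, n)`. -/
noncomputable def μX : Measure (ℕ × ℕ+) :=
  Measure.count.withDensity (fun x => 2 ^ x.1)

/-- The sawtooth functions `f_{j,M}` from Section 4 of Mirek–Słomian–Szarek. -/
noncomputable def fjM (j M : ℕ) (x : ℕ × ℕ+) (t : ℕ) : ℝ :=
  if x.1 ≤ M ∧ (x.2 : ℕ) ≤ 2 ^ (M - x.1) then
    (∑ m ∈ Finset.range (2 ^ (j - 1)),
      ((t : ℝ) - 2 ^ x.1 * ((((x.2 : ℕ) : ℝ) - 1) * 2 ^ j + 2 * m)) * (2 : ℝ)⁻¹ ^ x.1 *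
        Set.indicator
          (Set.Ico ((2:ℝ) ^ x.1 * ((((x.2 : ℕ) : ℝ) - 1) * 2 ^ j + 2 * m))
            ((2:ℝ) ^ x.1 * ((((x.2 : ℕ) : ℝ) - 1) * 2 ^ j + 2 * m + 1)))
          (fun _ => (1:ℝ)) (t : ℝ)) +
    (∑ m ∈ Finset.range (2 ^ (j - 1)),
      (-(t : ℝ) + 2 ^ x.1 * ((((x.2 : ℕ) : ℝ) - 1) * 2 ^ j + 2 * m + 2)) * (2 : ℝ)⁻¹ ^ x.1 *
        Set.indicator
          (Set.Ico ((2:ℝ) ^ x.1 * ((((x.2 : ℕ) : ℝ) - 1) * 2 ^ j + 2 * m + 1))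
            ((2:ℝ) ^ x.1 * ((((x.2 : ℕ) : ℝ) - 1) * 2 ^ j + 2 * m + 2)))
          (fun _ => (1:ℝ)) (t : ℝ))
  else 0

/-- The sequential `λ`-jump counting function `N_{λ,I}(a_t : t ∈ ℕ)`. -/
noncomputable def seqJumpCount (lam : ℝ) (I : ℕ → ℕ) (a : ℕ → ℝ) : ℝ≥0∞ :=
  Measure.count {k : ℕ |
    ENNReal.ofReal lam ≤ ⨆ t ∈ Set.Ico (I k) (I (k+1)), ENNReal.ofReal |a t - a (I k)|}

instance discreteMeasPNat : DiscreteMeasurableSpace ℕ+ := ⟨fun _ => trivial⟩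

lemma muX_eq (E : Set (ℕ × ℕ+)) :
    μX E = ∑' (k : ℕ) (n : ℕ+), E.indicator (fun x => (2:ℝ≥0∞) ^ x.1) (k, n) := by
  unfold μX
  rw [withDensity_apply _ (MeasurableSet.of_discrete), ← lintegral_indicator (MeasurableSet.of_discrete),
    lintegral_count, ENNReal.tsum_prod']

noncomputable def hat (y : ℝ) : ℝ := max 0 (1 - |y - 1|)

noncomputable def saw (P : ℕ) (u : ℝ) : ℝ := ∑ m ∈ Finset.range P, hat (u - 2 * m)

lemma hat_eq (y : ℝ) : hat y = y * Set.indicator (Set.Ico 0 1) (fun _ => (1:ℝ)) y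
    + (2 - y) * Set.indicator (Set.Ico 1 2) (fun _ => (1:ℝ)) y := by
  unfold hat
  simp only [Set.indicator, Set.mem_Ico]
  split_ifs with h1 h2 h2
  · linarith
  · rw [abs_of_neg (by linarith), max_eq_right] <;> linarith
  · rw [abs_of_nonneg (by linarith), max_eq_right] <;> linarith
  · rw [max_eq_left]
    · simp
    by_contra h
    push Not at h
    have h3 : |y - 1| < 1 := by linarith
    rw [abs_lt] at h3
    rcases lt_or_ge y 1 with h4 | h4
    · exact h1 ⟨by linarith, h4⟩
    · exact h2 ⟨h4, by linarith⟩

lemma hat_nonneg (y : ℝ) : 0 ≤ hat y := le_max_left _ _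

lemma hat_lip (y z : ℝ) : |hat y - hat z| ≤ |y - z| := by
  unfold hat
  have h1 := abs_max_sub_max_le_abs (1 - |y - 1|) (1 - |z - 1|) 0
  rw [max_comm 0, max_comm 0]
  refine h1.trans ?_
  have h2 := abs_abs_sub_abs_le (z - 1) (y - 1)
  have e1 : 1 - |y - 1| - (1 - |z - 1|) = |z-1| - |y-1| := by ring
  have e2 : z - 1 - (y - 1) = -(y - z) := by ring
  rw [e1]
  rw [e2, abs_neg] at h2
  exact h2

lemma hat_zero (y : ℝ) (h : y ≤ 0 ∨ 2 ≤ y) : hat y = 0 := by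
  unfold hat
  rw [max_eq_left]
  rcases h with h | h
  · rw [abs_of_nonpos (by linarith)]; linarith
  · rw [abs_of_nonneg (by linarith)]; linarith

lemma saw_zero (P : ℕ) (u : ℝ) (h : u ≤ 0 ∨ 2 * P ≤ u) : saw P u = 0 := by
  unfold saw
  apply Finset.sum_eq_zero
  intro m hm
  apply hat_zero
  have hm' : (m:ℝ) + 1 ≤ P := by exact_mod_cast Finset.mem_range.mp hm
  have : (0:ℝ) ≤ m := by positivity
  rcases h with h | h
  · left; linarith
  · right; linarith

lemma saw_lip' (P : ℕ) : ∀ (s t : ℝ), s ≤ t → |saw P t - saw P s| ≤ t - s := by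
  induction P with
  | zero => intro s t h; simp [saw]; exact h
  | succ P ih =>
    intro s t h
    have e : ∀ u, saw (P+1) u = saw P u + hat (u - 2 * P) := fun u => by
      simp [saw, Finset.sum_range_succ]
    rw [e, e]
    rcases le_total t (2 * P) with h1 | h1
    · rw [hat_zero (t - _) (by left; linarith), hat_zero (s - _) (by left; linarith)]
      simpa using ih s t h
    rcases le_total (2 * (P:ℝ)) s with h2 | h2
    · rw [saw_zero P t (Or.inr h1), saw_zero P s (Or.inr h2)]
      have := hat_lip (t - 2 * P) (s - 2 * P)
      have e3 : t - 2 * P - (s - 2 * P) = t - s := by ring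
      rw [e3, abs_of_nonneg (by linarith : 0 ≤ t - s)] at this
      simpa using this
    · have a1 := ih s (2 * P) h2
      have a2 := hat_lip (t - 2 * P) 0
      rw [saw_zero P t (Or.inr h1), hat_zero (s - _) (by left; linarith)]
      rw [saw_zero P _ (Or.inr le_rfl)] at a1
      rw [hat_zero 0 (by left; linarith), sub_zero, sub_zero,
        abs_of_nonneg (by linarith : 0 ≤ t - 2 * P)] at a2
      rw [abs_le] at *
      constructor <;> linarith [a1.1, a1.2, a2.1, a2.2]

lemma fjM_eq (j M : ℕ) (x : ℕ × ℕ+) (t : ℕ) (h : x.1 ≤ M ∧ (x.2 : ℕ) ≤ 2 ^ (M - x.1)) :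
    fjM j M x t = saw (2 ^ (j-1)) ((t:ℝ) * (2:ℝ)⁻¹ ^ x.1 - (((x.2 : ℕ) : ℝ) - 1) * 2 ^ j) := by
  unfold fjM saw
  rw [if_pos h, ← Finset.sum_add_distrib]
  apply Finset.sum_congr rfl
  intro m _
  rw [hat_eq]
  have hp : (0:ℝ) < 2 ^ x.1 := by positivity
  set K : ℝ := 2 ^ x.1
  have hk : (2:ℝ)⁻¹ ^ x.1 = K⁻¹ := by simp [K]
  rw [hk]
  set c : ℝ := (((x.2 : ℕ) : ℝ) - 1) * 2 ^ j
  set T : ℝ := (t:ℝ)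
  obtain ⟨v, hv⟩ : ∃ v, T = K * v := ⟨T / K, by field_simp⟩
  have e1 : T * K⁻¹ = v := by rw [hv]; field_simp
  have i1 : Set.indicator (Set.Ico (K * (c + 2 * m)) (K * (c + 2 * m + 1))) (fun _ => (1:ℝ)) T
      = Set.indicator (Set.Ico 0 1) (fun _ => (1:ℝ)) (v - c - 2 * m) := by
    simp only [Set.indicator, Set.mem_Ico, hv, mul_le_mul_iff_right₀ hp, mul_lt_mul_iff_right₀ hp]
    congr 1
    apply propext
    constructor <;> rintro ⟨a, b⟩ <;> constructor <;> linarith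
  have i2 : Set.indicator (Set.Ico (K * (c + 2 * m + 1)) (K * (c + 2 * m + 2))) (fun _ => (1:ℝ)) T
      = Set.indicator (Set.Ico 1 2) (fun _ => (1:ℝ)) (v - c - 2 * m) := by
    simp only [Set.indicator, Set.mem_Ico, hv, mul_le_mul_iff_right₀ hp, mul_lt_mul_iff_right₀ hp]
    congr 1
    apply propext
    constructor <;> rintro ⟨a, b⟩ <;> constructor <;> linarith
  rw [i1, i2, e1, hv]
  congr 1
  · field_simp
    ring
  · field_simp
    ring

/-- left endpoint -/
def lft (j : ℕ) (x : ℕ × ℕ+) : ℕ := 2 ^ x.1 * (((x.2:ℕ) - 1) * 2 ^ j)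
def rgt (j : ℕ) (x : ℕ × ℕ+) : ℕ := 2 ^ x.1 * ((x.2:ℕ) * 2 ^ j)

lemma fjM_zero (j M : ℕ) (hj : 1 ≤ j) (x : ℕ × ℕ+) (t : ℕ)
    (h : x.1 ≤ M ∧ (x.2 : ℕ) ≤ 2 ^ (M - x.1)) (ht : t < lft j x ∨ rgt j x ≤ t) :
    fjM j M x t = 0 := by
  rw [fjM_eq j M x t h]
  apply saw_zero
  have hp : (0:ℝ) < 2 ^ x.1 := by positivity
  have hn : 1 ≤ (x.2:ℕ) := x.2.pos
  have h2 : (2:ℝ) * 2 ^ (j-1) = 2 ^ j := by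
    rw [← pow_succ']; congr 1; omega
  rcases ht with ht | ht
  · left
    have : (t:ℝ) ≤ 2 ^ x.1 * ((((x.2:ℕ):ℝ) - 1) * 2 ^ j) := by
      have : (t:ℝ) ≤ (lft j x : ℕ) := by exact_mod_cast ht.le
      unfold lft at this
      push_cast [Nat.cast_sub hn] at this
      exact this
    rw [inv_pow, ← div_eq_mul_inv, sub_nonpos, div_le_iff₀ hp]
    linarith
  · right
    have : 2 ^ x.1 * (((x.2:ℕ):ℝ) * 2 ^ j) ≤ (t:ℝ) := by
      have : ((rgt j x : ℕ):ℝ) ≤ t := by exact_mod_cast ht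
      unfold rgt at this
      push_cast at this
      exact this
    push_cast
    rw [h2, inv_pow, ← div_eq_mul_inv, le_sub_iff_add_le, le_div_iff₀ hp]
    linarith

lemma fjM_lip (j M : ℕ) (x : ℕ × ℕ+) (s t : ℕ)
    (h : x.1 ≤ M ∧ (x.2 : ℕ) ≤ 2 ^ (M - x.1)) (hst : s ≤ t) :
    |fjM j M x t - fjM j M x s| ≤ ((t:ℝ) - s) * (2:ℝ)⁻¹ ^ x.1 := by
  rw [fjM_eq j M x t h, fjM_eq j M x s h]
  have hst' : (s:ℝ) ≤ t := by exact_mod_cast hst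
  have hp : (0:ℝ) ≤ (2:ℝ)⁻¹ ^ x.1 := by positivity
  refine (saw_lip' _ _ _ ?_).trans (le_of_eq (by ring))
  have := mul_le_mul_of_nonneg_right hst' hp
  linarith

def jset (lam : ℝ) (I : ℕ → ℕ) (a : ℕ → ℝ) : Set ℕ := {k : ℕ |
    ENNReal.ofReal lam ≤ ⨆ t ∈ Set.Ico (I k) (I (k+1)), ENNReal.ofReal |a t - a (I k)|}

lemma jset_mem {lam : ℝ} (hl : 0 < lam) {I : ℕ → ℕ} {a : ℕ → ℝ} {k : ℕ} (hk : k ∈ jset lam I a) :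
    ∃ t, I k ≤ t ∧ t < I (k+1) ∧ lam ≤ |a t - a (I k)| := by
  by_contra hcon
  push Not at hcon
  have hk' : ENNReal.ofReal lam ≤
    ⨆ t ∈ Set.Ico (I k) (I (k+1)), ENNReal.ofReal |a t - a (I k)| := hk
  rw [← Finset.coe_Ico] at hk'
  simp only [Finset.mem_coe] at hk'
  rw [← Finset.sup_eq_iSup] at hk'
  apply absurd hk' (not_le.mpr _)
  rw [Finset.sup_lt_iff (by simpa using hl)]
  intro t ht
  rw [Finset.mem_Ico] at ht
  exact (ENNReal.ofReal_lt_ofReal_iff hl).2 (hcon t ht.1 ht.2)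

lemma outside (j M N W : ℕ) (I : ℕ → ℕ) (x : ℕ × ℕ+)
    (h : ¬ (x.1 ≤ M ∧ (x.2 : ℕ) ≤ 2 ^ (M - x.1))) :
    ¬ ((2 ^ W : ℝ≥0∞) ≤ seqJumpCount ((2:ℝ)⁻¹ ^ N) I (fjM j M x)) := by
  have : jset ((2:ℝ)⁻¹ ^ N) I (fjM j M x) = ∅ := by
    rw [Set.eq_empty_iff_forall_notMem]
    intro k hk
    obtain ⟨t, _, _, h3⟩ := jset_mem (by positivity) hk
    have : ∀ s, fjM j M x s = 0 := fun s => by unfold fjM; rw [if_neg h]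
    rw [this, this] at h3
    have : (0:ℝ) < (2:ℝ)⁻¹ ^ N := by positivity
    rw [sub_zero, abs_zero] at h3
    linarith
  have e : seqJumpCount ((2:ℝ)⁻¹ ^ N) I (fjM j M x) =
    Measure.count (jset ((2:ℝ)⁻¹ ^ N) I (fjM j M x)) := rfl
  rw [e, this]
  simp

def dd (L : ℕ) (I : ℕ → ℕ) (i : ℕ) : ℕ := min (I (i+1)) L - min (I i) L

def Bset (j M N : ℕ) (I : ℕ → ℕ) (x : ℕ × ℕ+) : Set ℕ :=
  {i | (lft j x ≤ I i ∧ I i < rgt j x) ∧ 2 ^ x.1 ≤ 2 ^ N * dd (2 ^ (M + j)) I i}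

lemma rgt_le (j M : ℕ) (x : ℕ × ℕ+) (h : x.1 ≤ M ∧ (x.2 : ℕ) ≤ 2 ^ (M - x.1)) :
    rgt j x ≤ 2 ^ (M + j) := by
  unfold rgt
  calc 2 ^ x.1 * ((x.2:ℕ) * 2 ^ j) ≤ 2 ^ x.1 * (2 ^ (M - x.1) * 2 ^ j) := by gcongr; exact h.2
    _ = 2 ^ (M + j) := by rw [← mul_assoc, ← pow_add, ← pow_add]; congr 1; omega

lemma jset_sub (j M N : ℕ) (hj : 1 ≤ j) (I : ℕ → ℕ) (hI : StrictMono I) (x : ℕ × ℕ+)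
    (h : x.1 ≤ M ∧ (x.2 : ℕ) ≤ 2 ^ (M - x.1)) :
    ∃ i₀, jset ((2:ℝ)⁻¹ ^ N) I (fjM j M x) ⊆ insert i₀ (Bset j M N I x) := by
  have key : ∀ i ∈ jset ((2:ℝ)⁻¹ ^ N) I (fjM j M x), i ∈ Bset j M N I x ∨
      (I i < lft j x ∧ lft j x < I (i+1)) := by
    intro i hi
    obtain ⟨t, h1, h2, h3⟩ := jset_mem (by positivity) hi
    have hpos : (0:ℝ) < (2:ℝ)⁻¹ ^ N := by positivity
    rcases lt_or_ge (I i) (lft j x) with ha | ha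
    · right
      refine ⟨ha, ?_⟩
      by_contra hc
      push Not at hc
      rw [fjM_zero j M hj x t h (Or.inl (by omega)), fjM_zero j M hj x _ h (Or.inl ha)] at h3
      rw [sub_zero, abs_zero] at h3
      linarith
    rcases lt_or_ge (I i) (rgt j x) with hb | hb
    · left
      refine ⟨⟨ha, hb⟩, ?_⟩
      have e : fjM j M x t = fjM j M x (min t (rgt j x)) := by
        rcases le_total t (rgt j x) with hc | hc
        · rw [min_eq_left hc]
        · rw [min_eq_right hc, fjM_zero j M hj x t h (Or.inr hc),
            fjM_zero j M hj x _ h (Or.inr le_rfl)]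
      rw [e] at h3
      have hle : I i ≤ min t (rgt j x) := le_min h1 hb.le
      have h4 := h3.trans (fjM_lip j M x _ _ h hle)
      have hr := rgt_le j M x h
      have h5 : min t (rgt j x) - I i ≤ dd (2 ^ (M + j)) I i := by
        unfold dd; omega
      have h6 : (2:ℝ) ^ x.1 ≤ 2 ^ N * ((min t (rgt j x) : ℕ) - (I i : ℕ)) := by
        rw [inv_pow, inv_pow, ← div_eq_mul_inv, le_div_iff₀ (by positivity),
          inv_mul_le_iff₀ (by positivity)] at h4
        exact h4
      rw [← Nat.cast_sub hle] at h6
      have h7 : 2 ^ x.1 ≤ 2 ^ N * (min t (rgt j x) - I i) := by exact_mod_cast h6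
      exact h7.trans (Nat.mul_le_mul_left _ h5)
    · exfalso
      rw [fjM_zero j M hj x t h (Or.inr (by omega)), fjM_zero j M hj x _ h (Or.inr hb)] at h3
      rw [sub_zero, abs_zero] at h3
      linarith
  by_cases hex : ∃ i₀, I i₀ < lft j x ∧ lft j x < I (i₀+1)
  · obtain ⟨i₀, ha, hb⟩ := hex
    refine ⟨i₀, fun i hi => ?_⟩
    rcases key i hi with h1 | ⟨h1, h2⟩
    · exact Or.inr h1
    · left
      have q1 : i < i₀ + 1 := hI.lt_iff_lt.1 (h1.trans hb)
      have q2 : i₀ < i + 1 := hI.lt_iff_lt.1 (ha.trans h2)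
      omega
  · refine ⟨0, fun i hi => ?_⟩
    rcases key i hi with h1 | h1
    · exact Or.inr h1
    · exact absurd ⟨i, h1⟩ hex

lemma count_bound (j M N W : ℕ) (hj : 1 ≤ j) (hW : 1 ≤ W) (I : ℕ → ℕ) (hI : StrictMono I)
    (x : ℕ × ℕ+)
    (h : x.1 ≤ M ∧ (x.2 : ℕ) ≤ 2 ^ (M - x.1))
    (hx : (2 ^ W : ℝ≥0∞) ≤ seqJumpCount ((2:ℝ)⁻¹ ^ N) I (fjM j M x)) :
    (2:ℝ≥0∞) ^ W ≤ 2 * Measure.count (Bset j M N I x) := by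
  obtain ⟨i₀, hs⟩ := jset_sub j M N hj I hI x h
  have e : seqJumpCount ((2:ℝ)⁻¹ ^ N) I (fjM j M x) =
    Measure.count (jset ((2:ℝ)⁻¹ ^ N) I (fjM j M x)) := rfl
  rw [e] at hx
  have h1 : (2 ^ W : ℝ≥0∞) ≤ 1 + Measure.count (Bset j M N I x) := by
    refine hx.trans ((measure_mono hs).trans ?_)
    rw [Set.insert_eq]
    refine (measure_union_le _ _).trans ?_
    simp
  have h2 : (1:ℝ≥0∞) ≤ Measure.count (Bset j M N I x) := by
    have : (2:ℝ≥0∞) ≤ 2 ^ W := by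
      calc (2:ℝ≥0∞) = 2 ^ 1 := by simp
        _ ≤ 2 ^ W := pow_le_pow_right₀ (by norm_num) hW
    have h3 := this.trans h1
    rw [show (2:ℝ≥0∞) = 1 + 1 by norm_num] at h3
    exact (ENNReal.add_le_add_iff_left (by simp)).1 h3
  calc (2 ^ W : ℝ≥0∞) ≤ 1 + Measure.count (Bset j M N I x) := h1
    _ ≤ Measure.count (Bset j M N I x) + Measure.count (Bset j M N I x) := by gcongr
    _ = _ := by rw [two_mul]

lemma sum_pow_bound (D : ℕ) :
    ∑' k : ℕ, (if 2 ^ k ≤ D then (2:ℝ≥0∞) ^ k else 0) ≤ 2 * D := by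
  rcases Nat.eq_zero_or_pos D with rfl | hD
  · simp
  have h : ∀ k, 2 ^ k ≤ D ↔ k ∈ Finset.range (Nat.log 2 D + 1) := fun k => by
    rw [Finset.mem_range, Nat.lt_succ_iff, Nat.le_log_iff_pow_le (by norm_num) hD.ne']
  simp only [h]
  rw [tsum_eq_sum (s := Finset.range (Nat.log 2 D + 1)) (fun k hk => if_neg hk),
    Finset.sum_ite_mem, Finset.inter_self]
  have : ∑ k ∈ Finset.range (Nat.log 2 D + 1), 2 ^ k ≤ 2 * D := by
    rw [Nat.geomSum_eq (le_refl 2)]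
    have := Nat.pow_log_le_self 2 hD.ne'
    rw [pow_succ]
    simp
    omega
  exact_mod_cast this

lemma dd_sum (L : ℕ) (I : ℕ → ℕ) (hI : StrictMono I) :
    ∑' i, (dd L I i : ℝ≥0∞) ≤ L := by
  apply ENNReal.tsum_le_of_sum_range_le
  intro n
  have : ∑ i ∈ Finset.range n, dd L I i ≤ min (I n) L := by
    induction n with
    | zero => simp
    | succ n ih =>
      rw [Finset.sum_range_succ]
      have := hI (Nat.lt_succ_self n)
      unfold dd at *
      simp only [Nat.succ_eq_add_one] at this
      omega
  have := this.trans (min_le_right _ _)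
  exact_mod_cast this

lemma uniq_n (j k a : ℕ) (n n' : ℕ+) (h : lft j (k,n) ≤ a ∧ a < rgt j (k,n))
    (h' : lft j (k,n') ≤ a ∧ a < rgt j (k,n')) : n = n' := by
  unfold lft rgt at h h'
  simp only at h h'
  have key : ∀ m m' : ℕ+, 2 ^ k * (((m:ℕ) - 1) * 2 ^ j) ≤ a → a < 2 ^ k * ((m':ℕ) * 2 ^ j) →
      (m:ℕ) ≤ m' := by
    intro m m' h1 h2
    have h3 := h1.trans_lt h2
    have h4 := lt_of_mul_lt_mul_left h3 (Nat.zero_le _)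
    have h5 := lt_of_mul_lt_mul_right h4 (Nat.zero_le _)
    omega
  exact PNat.coe_injective (le_antisymm (key _ _ h.1 h'.2) (key _ _ h'.1 h.2))

open Classical in
lemma main_bound (j M N : ℕ) (I : ℕ → ℕ) (hI : StrictMono I) :
    ∑' (k : ℕ) (n : ℕ+), (2:ℝ≥0∞) ^ k * Measure.count (Bset j M N I (k,n))
      ≤ 2 ^ (M + j + 1 + N) := by
  have e : ∀ (k : ℕ) (n : ℕ+), (2:ℝ≥0∞) ^ k * Measure.count (Bset j M N I (k,n)) =
      ∑' i, (if i ∈ Bset j M N I (k,n) then (2:ℝ≥0∞) ^ k else 0) := by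
    intro k n
    rw [← lintegral_indicator_one MeasurableSet.of_discrete, lintegral_count, ← ENNReal.tsum_mul_left]
    congr 1
    ext i
    simp [Set.indicator]
  simp only [e]
  have e2 : ∀ k : ℕ, ∑' (n : ℕ+) (i : ℕ), (if i ∈ Bset j M N I (k,n) then (2:ℝ≥0∞) ^ k else 0)
      ≤ ∑' i : ℕ, (if 2 ^ k ≤ 2 ^ N * dd (2 ^ (M + j)) I i then (2:ℝ≥0∞) ^ k else 0) := by
    intro k
    rw [ENNReal.tsum_comm]
    apply ENNReal.tsum_le_tsum
    intro i
    by_cases hex : ∃ n, i ∈ Bset j M N I (k,n)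
    · obtain ⟨n, hn⟩ := hex
      rw [tsum_eq_single n]
      · rw [if_pos hn, if_pos hn.2]
      · intro n' hn'
        rw [if_neg]
        intro hc
        exact hn' (uniq_n j k (I i) _ _ hc.1 hn.1)
    · push Not at hex
      simp [hex]
  refine (ENNReal.tsum_le_tsum e2).trans ?_
  rw [ENNReal.tsum_comm]
  refine (ENNReal.tsum_le_tsum (fun i => sum_pow_bound _)).trans ?_
  push_cast
  simp only [← mul_assoc]
  rw [ENNReal.tsum_mul_left]
  refine (mul_le_mul_right (dd_sum _ I hI) _).trans (le_of_eq ?_)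
  push_cast
  ring

lemma triv_bound (M : ℕ) (E : Set (ℕ × ℕ+))
    (hE : ∀ x ∈ E, x.1 ≤ M ∧ (x.2 : ℕ) ≤ 2 ^ (M - x.1)) : μX E ≤ (M + 1) * 2 ^ M := by
  rw [muX_eq]
  have hk : ∀ k : ℕ, ∑' n : ℕ+, E.indicator (fun x => (2:ℝ≥0∞) ^ x.1) (k, n) ≤
      if k ∈ Finset.range (M+1) then 2 ^ M else 0 := by
    intro k
    split_ifs with h
    · have hkM : k ≤ M := by rw [Finset.mem_range] at h; omega
      rw [tsum_eq_sum (s := Finset.Icc (1:ℕ+) (Nat.toPNat (2 ^ (M - k)) (by positivity)))]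
      · refine (Finset.sum_le_card_nsmul _ _ (2 ^ k) ?_).trans ?_
        · intro n _
          exact Set.indicator_le_self' (fun _ _ => zero_le) _
        · rw [PNat.card_Icc]
          simp only [PNat.one_coe, add_tsub_cancel_right, nsmul_eq_mul]
          change (((2 ^ (M - k) : ℕ) : ℝ≥0∞)) * 2 ^ k ≤ 2 ^ M
          push_cast
          rw [← pow_add]
          apply le_of_eq
          congr 1
          omega
      · intro n hn
        rw [Set.indicator_of_notMem]
        intro hc
        apply hn
        rw [Finset.mem_Icc]
        exact ⟨PNat.one_le _, (hE _ hc).2⟩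
    · rw [ENNReal.tsum_eq_zero.2]
      intro n
      rw [Set.indicator_of_notMem]
      intro hc
      apply h
      have := (hE _ hc).1
      simp at this ⊢
      omega
  refine (ENNReal.tsum_le_tsum hk).trans ?_
  rw [tsum_eq_sum (s := Finset.range (M + 1)) (fun k hk => if_neg hk),
    Finset.sum_ite_mem, Finset.inter_self]
  simp

/-- Lemma 4.5 of Mirek–Słomian–Szarek: the distributional estimate for the
sequential jump counting function of `f_{j,M}`. -/
theorem stmt11 (j M N W : ℕ) (hj : 1 ≤ j) (hM : 1 ≤ M) (hN : N ≤ M) (hW : W ≤ j + N)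
    (I : ℕ → ℕ) (hI : StrictMono I) :
    μX {x : ℕ × ℕ+ | (2 ^ W : ℝ≥0∞) ≤ seqJumpCount ((2:ℝ)⁻¹ ^ N) I (fjM j M x)}
      ≤ 2 ^ (M + j + 2 + N - W) + (N + 1) * 2 ^ M
        + (if W = 0 then (M + 1) * 2 ^ M else 0) := by
  set E := {x : ℕ × ℕ+ | (2 ^ W : ℝ≥0∞) ≤ seqJumpCount ((2:ℝ)⁻¹ ^ N) I (fjM j M x)} with hEdef
  have hE : ∀ x ∈ E, x.1 ≤ M ∧ (x.2 : ℕ) ≤ 2 ^ (M - x.1) := by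
    intro x hx
    by_contra h
    exact outside j M N W I x h hx
  by_cases h0 : W = 0
  · rw [if_pos h0]
    refine (triv_bound M E hE).trans ?_
    push_cast
    exact le_add_self
  have key : (2:ℝ≥0∞) ^ W * μX E ≤ 2 ^ W * 2 ^ (M + j + 2 + N - W) := by
    rw [muX_eq, ← pow_add, ← ENNReal.tsum_mul_left]
    simp only [← ENNReal.tsum_mul_left]
    have : ∀ (k : ℕ) (n : ℕ+), (2:ℝ≥0∞) ^ W * E.indicator (fun x => (2:ℝ≥0∞) ^ x.1) (k, n) ≤
        2 * (2 ^ k * Measure.count (Bset j M N I (k,n))) := by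
      intro k n
      by_cases hx : (k, n) ∈ E
      · rw [Set.indicator_of_mem hx]
        have := count_bound j M N W hj (by omega) I hI (k,n) (hE _ hx) hx
        calc (2:ℝ≥0∞) ^ W * 2 ^ k ≤ (2 * Measure.count (Bset j M N I (k,n))) * 2 ^ k := by gcongr
          _ = _ := by ring
      · rw [Set.indicator_of_notMem hx]; simp
    refine (ENNReal.tsum_le_tsum fun k => ENNReal.tsum_le_tsum fun n => this k n).trans ?_
    simp only [ENNReal.tsum_mul_left]
    have h5 := main_bound j M N I hI
    simp only [ENNReal.tsum_mul_left] at h5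
    refine (mul_le_mul_right h5 _).trans (le_of_eq ?_)
    rw [← pow_succ']
    congr 1
    omega
  have h6 := (ENNReal.mul_le_mul_iff_right (by positivity) (by simp)).1 key
  rw [add_assoc]
  exact h6.trans le_self_add
end

section
/- With X, μ and f_{j,M} as in the context, let q > 0 be fixed. Then there is a constant depending only on q such that uniformly in j, M ∈ ℤ₊ and N ∈ ℕ with N ≤ M: sup_{Ī ∈ 𝔖_∞(ℕ)} ∫_X (N_{2^{-N}, Ī} f_{j,M}(x))^q dμ(x) ≲ (M+1)·2^M + (N+1)·2^{M+(j+N)q} if q > 1; ≲ (M+1)·2^M + (j+N)·2^{M+j+N} if q = 1; and ≲ (M+1)·2^M + 2^{M+j+N} if 0 < q < 1. -/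
open MeasureTheory ENNReal

theorem tri_val (K m : ℕ) (hm : m < K) (c b t : ℝ) (hc : 0 < c)
    (h1 : c * (b + 2 * m) ≤ t) (h2 : t < c * (b + 2 * m + 2)) :
    (∑ m ∈ Finset.range K,
      (t - c * (b + 2 * m)) * c⁻¹ *
        Set.indicator (Set.Ico (c * (b + 2 * m)) (c * (b + 2 * m + 1)))
          (fun _ => (1:ℝ)) t) +
    (∑ m ∈ Finset.range K,
      (-t + c * (b + 2 * m + 2)) * c⁻¹ *
        Set.indicator (Set.Ico (c * (b + 2 * m + 1)) (c * (b + 2 * m + 2)))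
          (fun _ => (1:ℝ)) t) = 1 - |t / c - b - 2 * m - 1| := by
  have key : ∀ m' : ℕ, m' ≠ m → ¬ (c * (b + 2 * m') ≤ t ∧ t < c * (b + 2 * m' + 2)) := by
    rintro m' hne ⟨h3, h4⟩
    have h5 : b + 2 * (m':ℝ) < b + 2 * m + 2 := lt_of_mul_lt_mul_left (h3.trans_lt h2) hc.le
    have h6 : b + 2 * (m:ℝ) < b + 2 * m' + 2 := lt_of_mul_lt_mul_left (h1.trans_lt h4) hc.le
    have h7 : (m':ℝ) < m + 1 := by linarith
    have h8 : (m:ℝ) < m' + 1 := by linarith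
    have h7' : m' < m + 1 := by exact_mod_cast h7
    have h8' : m < m' + 1 := by exact_mod_cast h8
    omega
  rw [Finset.sum_eq_single m, Finset.sum_eq_single m]
  · have e : t = c * (t / c) := by field_simp
    by_cases h : t < c * (b + 2 * m + 1)
    · rw [Set.indicator_of_mem (by exact ⟨h1, h⟩),
        Set.indicator_of_notMem (fun hh => absurd hh.1 (not_le.2 h))]
      have : t / c < b + 2 * m + 1 := by rw [div_lt_iff₀ hc]; linarith
      rw [abs_of_neg (by linarith)]
      field_simp
      ring
    · push Not at h
      rw [Set.indicator_of_notMem (fun hh => absurd hh.2 (not_lt.2 h)),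
        Set.indicator_of_mem (by exact ⟨h, h2⟩)]
      have : b + 2 * m + 1 ≤ t / c := by rw [le_div_iff₀ hc]; linarith
      rw [abs_of_nonneg (by linarith)]
      field_simp
      ring
  · intro m' _ hne
    rw [Set.indicator_of_notMem, mul_zero]
    rintro ⟨h3, h4⟩
    exact key m' hne ⟨by nlinarith, h4⟩
  · intro h; exact absurd (Finset.mem_range.2 hm) h
  · intro m' _ hne
    rw [Set.indicator_of_notMem, mul_zero]
    rintro ⟨h3, h4⟩
    exact key m' hne ⟨h3, by nlinarith⟩
  · intro h; exact absurd (Finset.mem_range.2 hm) h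

theorem fjM_zero_of (j M : ℕ) (x : ℕ × ℕ+) (h : ¬ (x.1 ≤ M ∧ (x.2 : ℕ) ≤ 2 ^ (M - x.1))) (t : ℕ) :
    fjM j M x t = 0 := by
  simp only [fjM, if_neg h]

theorem fjM_zero_left (j M k : ℕ) (n : ℕ+) (p t : ℕ) (hj : 1 ≤ j) (hn : (n : ℕ) = p + 1)
    (ht : t < 2 ^ k * p * 2 ^ j ∨ 2 ^ k * (p + 1) * 2 ^ j ≤ t) :
    fjM j M (k, n) t = 0 := by
  unfold fjM
  split_ifs
  swap
  · rfl
  have hc : (0:ℝ) < 2 ^ k := by positivity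
  have hJ : (2:ℝ) ^ j = 2 * 2 ^ (j - 1) := by
    rw [← pow_succ']; congr 1; omega
  have key : ∀ m ∈ Finset.range (2 ^ (j - 1)), ¬ ((2:ℝ) ^ k * ((((n : ℕ) : ℝ) - 1) * 2 ^ j + 2 * m) ≤ t ∧
      (t:ℝ) < (2:ℝ) ^ k * ((((n : ℕ) : ℝ) - 1) * 2 ^ j + 2 * m + 2)) := by
    rintro m hm ⟨h1, h2⟩
    rw [hn] at h1 h2
    push_cast at h1 h2
    have hm0 : (0:ℝ) ≤ 2 ^ k * (m:ℝ) := by positivity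
    have hm' : (m:ℝ) + 1 ≤ 2 ^ (j - 1) := by
      have : m + 1 ≤ 2 ^ (j - 1) := by simpa using hm
      exact_mod_cast this
    rcases ht with ht | ht
    · have ht' : (t:ℝ) < 2 ^ k * p * 2 ^ j := by exact_mod_cast ht
      nlinarith
    · have ht' : (2:ℝ) ^ k * (p + 1) * 2 ^ j ≤ t := by exact_mod_cast ht
      have : (2:ℝ) ^ k * (2 * (m:ℝ) + 2) ≤ 2 ^ k * 2 ^ j := by
        apply mul_le_mul_of_nonneg_left _ hc.le
        linarith
      nlinarith
  rw [Finset.sum_eq_zero, Finset.sum_eq_zero, add_zero]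
  · intro m hm
    rw [Set.indicator_of_notMem, mul_zero]
    rintro ⟨h3, h4⟩
    exact key m hm ⟨by simp only at h3; nlinarith, h4⟩
  · intro m hm
    rw [Set.indicator_of_notMem, mul_zero]
    rintro ⟨h3, h4⟩
    exact key m hm ⟨h3, by simp only at h4; nlinarith⟩

theorem fjM_val (j M k : ℕ) (n : ℕ+) (p t : ℕ) (hj : 1 ≤ j) (hn : (n : ℕ) = p + 1)
    (hs : k ≤ M ∧ (n : ℕ) ≤ 2 ^ (M - k))
    (h1 : 2 ^ k * p * 2 ^ j ≤ t) (h2 : t < 2 ^ k * (p + 1) * 2 ^ j) :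
    ∃ m : ℕ, 2 * (m:ℝ) ≤ t / 2 ^ k - p * 2 ^ j ∧ (t:ℝ) / 2 ^ k - p * 2 ^ j < 2 * m + 2 ∧
    fjM j M (k, n) t = 1 - |(t:ℝ) / 2 ^ k - p * 2 ^ j - 2 * m - 1| := by
  have hc : (0:ℝ) < 2 ^ k := by positivity
  have hJ : 2 ^ j = 2 * 2 ^ (j - 1) := by
    rw [← pow_succ']; congr 1; omega
  obtain ⟨u, rfl⟩ := Nat.exists_eq_add_of_le h1
  have hu : u < 2 ^ k * 2 * 2 ^ (j - 1) := by
    have : 2 ^ k * (p + 1) * 2 ^ j = 2 ^ k * p * 2 ^ j + 2 ^ k * 2 ^ j := by ring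
    rw [this] at h2
    rw [mul_assoc, ← hJ]; omega
  have hpos : 0 < 2 ^ k * 2 := by positivity
  have hm := Nat.div_lt_of_lt_mul hu
  have hd1 := Nat.div_mul_le_self u (2 ^ k * 2)
  have hd2 := Nat.lt_div_mul_add (a := u) hpos
  set m := u / (2 ^ k * 2) with hmdef
  have hd1' : (m:ℝ) * (2 ^ k * 2) ≤ u := by exact_mod_cast hd1
  have hd2' : (u:ℝ) < m * (2 ^ k * 2) + 2 ^ k * 2 := by exact_mod_cast hd2
  have e : ((2 ^ k * p * 2 ^ j + u : ℕ) : ℝ) / 2 ^ k - p * 2 ^ j = u / 2 ^ k := by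
    push_cast; field_simp; ring
  refine ⟨m, ?_, ?_, ?_⟩
  · rw [e, le_div_iff₀ hc]; linarith
  · rw [e, div_lt_iff₀ hc]; linarith
  · unfold fjM
    rw [if_pos hs]
    have := tri_val (2 ^ (j - 1)) m hm (2 ^ k) ((((n : ℕ) : ℝ) - 1) * 2 ^ j)
      ((2 ^ k * p * 2 ^ j + u : ℕ) : ℝ) hc (by rw [hn]; push_cast; nlinarith)
      (by rw [hn]; push_cast; nlinarith)
    simp only [inv_pow]
    rw [this, hn]
    push_cast
    ring_nf

theorem fjM_lip_s12 (j M k : ℕ) (n : ℕ+) (p s t : ℕ) (hj : 1 ≤ j) (hn : (n : ℕ) = p + 1)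
    (hs : k ≤ M ∧ (n : ℕ) ≤ 2 ^ (M - k)) (hst : s ≤ t)
    (h1 : 2 ^ k * p * 2 ^ j ≤ s) (h2 : t < 2 ^ k * (p + 1) * 2 ^ j) :
    |fjM j M (k, n) t - fjM j M (k, n) s| ≤ ((t:ℝ) - s) / 2 ^ k := by
  obtain ⟨m, a1, a2, a3⟩ := fjM_val j M k n p s hj hn hs h1 (by omega)
  obtain ⟨m', b1, b2, b3⟩ := fjM_val j M k n p t hj hn hs (by omega) h2
  have hc : (0:ℝ) < 2 ^ k := by positivity
  have hst' : (s:ℝ) / 2 ^ k ≤ t / 2 ^ k := by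
    have : (s:ℝ) ≤ t := by exact_mod_cast hst
    gcongr
  rw [a3, b3, sub_div]
  generalize (s:ℝ) / 2 ^ k = S at *
  generalize (t:ℝ) / 2 ^ k = T at *
  generalize (p:ℝ) * 2 ^ j = B at *
  rcases lt_trichotomy m m' with h | h | h
  · have h' : (m:ℝ) + 1 ≤ m' := by exact_mod_cast h
    rw [abs_le]
    constructor <;> rcases abs_cases (S - B - 2 * m - 1) with ⟨e1, _⟩ | ⟨e1, _⟩ <;>
      rcases abs_cases (T - B - 2 * m' - 1) with ⟨e2, _⟩ | ⟨e2, _⟩ <;> rw [e1, e2] <;> linarith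
  · subst h
    rw [abs_le]
    constructor <;> rcases abs_cases (S - B - 2 * m - 1) with ⟨e1, _⟩ | ⟨e1, _⟩ <;>
      rcases abs_cases (T - B - 2 * m - 1) with ⟨e2, _⟩ | ⟨e2, _⟩ <;> rw [e1, e2] <;> linarith
  · exfalso
    have h' : (m':ℝ) + 1 ≤ m := by exact_mod_cast h
    linarith

theorem sum_len (I : ℕ → ℕ) (hI : StrictMono I) (L R : ℕ) (hLR : L ≤ R) (A : Finset ℕ)
    (hA : ∀ i ∈ A, L ≤ I i ∧ I (i + 1) ≤ R) :
    ∑ i ∈ A, (I (i + 1) - I i) ≤ R - L := by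
  have hmono : Monotone (fun i => min (max (I i) L) R) := by
    intro a b hab
    have := hI.monotone hab
    simp only
    omega
  obtain ⟨K, hK⟩ : ∃ K, A ⊆ Finset.range K := ⟨A.sup id + 1, fun i hi => by
    have := Finset.le_sup (f := id) hi
    simp only [id] at this
    simp; omega⟩
  calc ∑ i ∈ A, (I (i + 1) - I i)
      ≤ ∑ i ∈ A, (min (max (I (i + 1)) L) R - min (max (I i) L) R) := by
        apply Finset.sum_le_sum
        intro i hi
        have := hA i hi
        have := hI (Nat.lt_succ_self i)
        simp only [Nat.succ_eq_add_one] at this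
        omega
    _ ≤ ∑ i ∈ Finset.range K, (min (max (I (i + 1)) L) R - min (max (I i) L) R) :=
        Finset.sum_le_sum_of_subset hK
    _ = min (max (I K) L) R - min (max (I 0) L) R := Finset.sum_range_tsub hmono K
    _ ≤ R - L := by omega

theorem sum_pow_le (X M : ℕ) :
    ∑ k ∈ Finset.range M, (if 2 ^ k ≤ X then 2 ^ k else 0) ≤ 2 * X := by
  have h : ∀ M, ∑ k ∈ Finset.range M, (if 2 ^ k ≤ X then 2 ^ k else 0) ≤ 2 * X ∧
      ∑ k ∈ Finset.range M, (if 2 ^ k ≤ X then 2 ^ k else 0) ≤ 2 ^ M := by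
    intro M
    induction M with
    | zero => simp
    | succ M ih =>
      rw [Finset.sum_range_succ]
      have := pow_succ 2 M
      split_ifs <;> omega
  exact (h M).1

/-- indices of intervals contained in the support, long enough. -/
def goodSet (I : ℕ → ℕ) (j N k p : ℕ) : Finset ℕ :=
  {i ∈ Finset.range (2 ^ k * (p + 1) * 2 ^ j) | 2 ^ k * p * 2 ^ j ≤ I i ∧
    I (i + 1) ≤ 2 ^ k * (p + 1) * 2 ^ j ∧ 2 ^ k ≤ 2 ^ N * (I (i + 1) - I i)}

theorem goodSet_card (I : ℕ → ℕ) (hI : StrictMono I) (j N k p : ℕ) :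
    (goodSet I j N k p).card ≤ 2 ^ (j + N) := by
  have h := sum_len I hI (2 ^ k * p * 2 ^ j) (2 ^ k * (p + 1) * 2 ^ j) (by gcongr; omega)
    (goodSet I j N k p) (by
      intro i hi
      simp only [goodSet, Finset.mem_filter] at hi
      exact ⟨hi.2.1, hi.2.2.1⟩)
  have h2 : (goodSet I j N k p).card * 2 ^ k ≤ ∑ i ∈ goodSet I j N k p, 2 ^ N * (I (i + 1) - I i) := by
    rw [← smul_eq_mul]
    apply Finset.card_nsmul_le_sum
    intro i hi
    simp only [goodSet, Finset.mem_filter] at hi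
    exact hi.2.2.2
  rw [← Finset.mul_sum] at h2
  have h3 : 2 ^ k * (p + 1) * 2 ^ j - 2 ^ k * p * 2 ^ j = 2 ^ k * 2 ^ j := by
    rw [Nat.sub_eq_iff_eq_add (by gcongr; omega)]; ring
  rw [h3] at h
  have h4 : (goodSet I j N k p).card * 2 ^ k ≤ 2 ^ (j + N) * 2 ^ k := by
    calc _ ≤ _ := h2
      _ ≤ 2 ^ N * (2 ^ k * 2 ^ j) := by gcongr
      _ = _ := by ring
  exact Nat.le_of_mul_le_mul_right h4 (by positivity)

theorem goodSet_sum (I : ℕ → ℕ) (hI : StrictMono I) (j M N : ℕ) :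
    ∑ k ∈ Finset.range (M + 1), ∑ p ∈ Finset.range (2 ^ (M - k)),
      2 ^ k * (goodSet I j N k p).card ≤ 2 * 2 ^ (M + j + N) := by
  set D := 2 ^ (M + j) with hD
  set A : Finset ℕ := {i ∈ Finset.range D | I (i + 1) ≤ D} with hA
  have step : ∀ k ∈ Finset.range (M + 1), ∑ p ∈ Finset.range (2 ^ (M - k)),
      2 ^ k * (goodSet I j N k p).card ≤
      ∑ i ∈ A, if 2 ^ k ≤ 2 ^ N * (I (i + 1) - I i) then 2 ^ k else 0 := by
    intro k hk
    have hk' : k ≤ M := by simp at hk; omega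
    rw [← Finset.mul_sum, ← Finset.card_biUnion, ← Finset.sum_filter, Finset.sum_const,
      smul_eq_mul, mul_comm]
    · apply Nat.mul_le_mul_right
      apply Finset.card_le_card
      intro i hi
      simp only [Finset.mem_biUnion, goodSet, Finset.mem_filter, Finset.mem_range] at hi
      obtain ⟨p, hp, h1, h2, h3, h4⟩ := hi
      have hb : 2 ^ k * (p + 1) * 2 ^ j ≤ D := by
        calc 2 ^ k * (p + 1) * 2 ^ j ≤ 2 ^ k * 2 ^ (M - k) * 2 ^ j := by gcongr; omega
          _ = D := by rw [hD, ← pow_add, ← pow_add]; congr 1; omega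
      simp only [hA, Finset.mem_filter, Finset.mem_range]
      exact ⟨⟨by omega, by omega⟩, h4⟩
    · intro p _ p' _ hne
      rw [Function.onFun, Finset.disjoint_left]
      intro i h1 h2
      simp only [goodSet, Finset.mem_filter] at h1 h2
      have hlt := hI (Nat.lt_succ_self i)
      simp only [Nat.succ_eq_add_one] at hlt
      apply hne
      have e1 : 2 ^ k * p * 2 ^ j < 2 ^ k * (p' + 1) * 2 ^ j := by omega
      have e2 : 2 ^ k * p' * 2 ^ j < 2 ^ k * (p + 1) * 2 ^ j := by omega
      have e1 := Nat.lt_of_mul_lt_mul_left (Nat.lt_of_mul_lt_mul_right e1)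
      have e2 := Nat.lt_of_mul_lt_mul_left (Nat.lt_of_mul_lt_mul_right e2)
      omega
  calc _ ≤ _ := Finset.sum_le_sum step
    _ = ∑ i ∈ A, ∑ k ∈ Finset.range (M + 1),
        if 2 ^ k ≤ 2 ^ N * (I (i + 1) - I i) then 2 ^ k else 0 := Finset.sum_comm
    _ ≤ ∑ i ∈ A, 2 * (2 ^ N * (I (i + 1) - I i)) := Finset.sum_le_sum fun i _ => sum_pow_le _ _
    _ = 2 * 2 ^ N * ∑ i ∈ A, (I (i + 1) - I i) := by
        rw [Finset.mul_sum]; simp only [mul_assoc]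
    _ ≤ 2 * 2 ^ N * (D - 0) := by
        gcongr
        apply sum_len I hI 0 D (Nat.zero_le _)
        intro i hi
        simp only [hA, Finset.mem_filter] at hi
        exact ⟨Nat.zero_le _, hi.2⟩
    _ = _ := by rw [hD, Nat.sub_zero]; ring

theorem count_cross (I : ℕ → ℕ) (hI : StrictMono I) (L : ℕ) :
    Measure.count {i : ℕ | I i < L ∧ L < I (i + 1)} ≤ 1 := by
  have hs : {i : ℕ | I i < L ∧ L < I (i + 1)}.Subsingleton := by
    rintro a ⟨ha1, ha2⟩ b ⟨hb1, hb2⟩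
    have h1 : a < b + 1 := hI.lt_iff_lt.1 (ha1.trans hb2)
    have h2 : b < a + 1 := hI.lt_iff_lt.1 (hb1.trans ha2)
    omega
  rcases hs.eq_empty_or_singleton with h | ⟨i, h⟩
  · rw [h]; simp
  · rw [h, Measure.count_singleton]

theorem jump_le (j M N k : ℕ) (n : ℕ+) (p : ℕ) (hj : 1 ≤ j) (hn : (n : ℕ) = p + 1)
    (hs : k ≤ M ∧ (n : ℕ) ≤ 2 ^ (M - k)) (I : ℕ → ℕ) (hI : StrictMono I) :
    seqJumpCount ((2:ℝ)⁻¹ ^ N) I (fjM j M (k, n)) ≤ 2 + (goodSet I j N k p).card := by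
  set L := 2 ^ k * p * 2 ^ j with hL
  set R := 2 ^ k * (p + 1) * 2 ^ j with hR
  have hsub : {i : ℕ | ENNReal.ofReal ((2:ℝ)⁻¹ ^ N) ≤ ⨆ t ∈ Set.Ico (I i) (I (i+1)),
      ENNReal.ofReal |fjM j M (k, n) t - fjM j M (k, n) (I i)|} ⊆
      ({i : ℕ | I i < L ∧ L < I (i + 1)} ∪ {i : ℕ | I i < R ∧ R < I (i + 1)}) ∪
        (goodSet I j N k p : Set ℕ) := by
    intro i hi
    simp only [Set.mem_ofPred_eq] at hi
    have hlt := hI (Nat.lt_succ_self i)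
    simp only [Nat.succ_eq_add_one] at hlt
    have hid := hI.id_le i
    simp only [id] at hid
    by_cases c1 : I i < L ∧ L < I (i + 1)
    · exact Or.inl (Or.inl c1)
    by_cases c2 : I i < R ∧ R < I (i + 1)
    · exact Or.inl (Or.inr c2)
    right
    by_cases c3 : I (i + 1) ≤ L ∨ R ≤ I i
    · exfalso
      have : (⨆ t ∈ Set.Ico (I i) (I (i+1)),
          ENNReal.ofReal |fjM j M (k, n) t - fjM j M (k, n) (I i)|) ≤ 0 := by
        apply iSup₂_le
        intro t ht
        have := ht.1
        have := ht.2
        rw [fjM_zero_left j M k n p t hj hn (by omega),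
          fjM_zero_left j M k n p (I i) hj hn (by omega)]
        simp
      have h2 := hi.trans this
      rw [nonpos_iff_eq_zero, ENNReal.ofReal_eq_zero] at h2
      have : (0:ℝ) < (2:ℝ)⁻¹ ^ N := by positivity
      linarith
    · have : (⨆ t ∈ Set.Ico (I i) (I (i+1)),
          ENNReal.ofReal |fjM j M (k, n) t - fjM j M (k, n) (I i)|) ≤
          ENNReal.ofReal (((I (i + 1) : ℝ) - I i) / 2 ^ k) := by
        apply iSup₂_le
        intro t ht
        have h1 := ht.1
        have h2 := ht.2
        apply ENNReal.ofReal_le_ofReal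
        refine (fjM_lip_s12 j M k n p (I i) t hj hn hs h1 (by omega) (by omega)).trans ?_
        have : (t:ℝ) ≤ I (i + 1) := by exact_mod_cast h2.le
        gcongr
      have h2 := hi.trans this
      have hlt' : (I i : ℝ) < I (i + 1) := by exact_mod_cast hlt
      rw [ENNReal.ofReal_le_ofReal_iff (by
        apply div_nonneg <;> [linarith; positivity]), inv_pow,
        le_div_iff₀ (by positivity), inv_mul_le_iff₀ (by positivity)] at h2
      simp only [goodSet, Finset.coe_filter, Finset.mem_range, Set.mem_ofPred_eq]
      refine ⟨by omega, by omega, by omega, ?_⟩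
      rw [← Nat.cast_sub hlt.le] at h2
      exact_mod_cast h2
  unfold seqJumpCount
  calc _ ≤ _ := measure_mono hsub
    _ ≤ _ := measure_union_le _ _
    _ ≤ (1 + 1) + (goodSet I j N k p).card := by
      gcongr
      · exact (measure_union_le _ _).trans (add_le_add (count_cross I hI L) (count_cross I hI R))
      · rw [Measure.count_apply_finset]
    _ = _ := by norm_num

theorem jump_zero (j M N : ℕ) (x : ℕ × ℕ+) (h : ¬ (x.1 ≤ M ∧ (x.2 : ℕ) ≤ 2 ^ (M - x.1)))
    (I : ℕ → ℕ) : seqJumpCount ((2:ℝ)⁻¹ ^ N) I (fjM j M x) = 0 := by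
  unfold seqJumpCount
  have : {k : ℕ | ENNReal.ofReal ((2:ℝ)⁻¹ ^ N) ≤ ⨆ t ∈ Set.Ico (I k) (I (k+1)),
    ENNReal.ofReal |fjM j M x t - fjM j M x (I k)|} = ∅ := by
    ext i
    simp only [fjM_zero_of j M x h]
    simp
  rw [this, measure_empty]

theorem lint_bound (j M N : ℕ) (I : ℕ → ℕ) (hI : StrictMono I) (F : ℕ × ℕ+ → ℝ≥0∞)
    (c P : ℝ≥0∞) (h0 : ∀ x : ℕ × ℕ+, ¬ (x.1 ≤ M ∧ (x.2 : ℕ) ≤ 2 ^ (M - x.1)) → F x = 0)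
    (h1 : ∀ (k : ℕ) (n : ℕ+) (p : ℕ), (n : ℕ) = p + 1 → (k ≤ M ∧ (n : ℕ) ≤ 2 ^ (M - k)) →
      F (k, n) ≤ c * (1 + (goodSet I j N k p).card * P)) :
    ∫⁻ x, F x ∂μX ≤ c * ((M + 1) * 2 ^ M + 2 * 2 ^ (M + j + N) * P) := by
  have e1 : ∫⁻ x, F x ∂μX = ∑' x : ℕ × ℕ+, 2 ^ x.1 * F x := by
    unfold μX
    rw [lintegral_withDensity_eq_lintegral_mul _ (measurable_of_countable _)
      (measurable_of_countable _), lintegral_count]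
    rfl
  rw [e1, ENNReal.tsum_prod', tsum_eq_sum (s := Finset.range (M + 1))]
  swap
  · intro k hk
    simp only [Finset.mem_range, not_lt] at hk
    rw [ENNReal.tsum_eq_zero]
    intro n
    rw [h0 _ (by simp; omega), mul_zero]
  have inner : ∀ k ∈ Finset.range (M + 1), ∑' n : ℕ+, (2:ℝ≥0∞) ^ k * F (k, n) ≤
      ∑ p ∈ Finset.range (2 ^ (M - k)), 2 ^ k * (c * (1 + (goodSet I j N k p).card * P)) := by
    intro k hk
    have hk' : k ≤ M := by simp at hk; omega
    rw [← Equiv.pnatEquivNat.symm.tsum_eq, tsum_eq_sum (s := Finset.range (2 ^ (M - k)))]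
    · apply Finset.sum_le_sum
      intro p hp
      gcongr
      have hp' := Finset.mem_range.1 hp
      exact h1 k _ p (by simp) ⟨hk', by simpa using hp'⟩
    · intro p hp
      simp only [Finset.mem_range, not_lt] at hp
      rw [h0 _ (by simp; omega), mul_zero]
  refine (Finset.sum_le_sum inner).trans ?_
  have e2 : ∑ k ∈ Finset.range (M + 1), ∑ p ∈ Finset.range (2 ^ (M - k)),
      (2:ℝ≥0∞) ^ k * (c * (1 + (goodSet I j N k p).card * P)) =
      c * (((∑ k ∈ Finset.range (M + 1), ∑ p ∈ Finset.range (2 ^ (M - k)), 2 ^ k : ℕ) : ℝ≥0∞) +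
       ((∑ k ∈ Finset.range (M + 1), ∑ p ∈ Finset.range (2 ^ (M - k)),
        2 ^ k * (goodSet I j N k p).card : ℕ) : ℝ≥0∞) * P) := by
    push_cast
    rw [Finset.sum_mul, ← Finset.sum_add_distrib, Finset.mul_sum]
    refine Finset.sum_congr rfl fun k _ => ?_
    rw [Finset.sum_mul, ← Finset.sum_add_distrib, Finset.mul_sum]
    refine Finset.sum_congr rfl fun p _ => ?_
    ring
  have e3 : ∑ k ∈ Finset.range (M + 1), ∑ p ∈ Finset.range (2 ^ (M - k)), 2 ^ k =
      (M + 1) * 2 ^ M := by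
    rw [Finset.sum_congr rfl (g := fun _ => 2 ^ M)]
    · simp
    · intro k hk
      have hk' : k ≤ M := by simp at hk; omega
      simp only [Finset.sum_const, Finset.card_range, smul_eq_mul]
      rw [← pow_add]; congr 1; omega
  rw [e2, e3]
  gcongr
  · push_cast; rfl
  · exact_mod_cast goodSet_sum I hI j M N

theorem rpow_big (q : ℝ) (hq : 1 < q) (a e : ℕ) (ha : a ≤ 2 ^ e) :
    (2 + (a:ℝ≥0∞)) ^ q ≤ 3 ^ q * (1 + a * (2:ℝ≥0∞) ^ (e * (q - 1))) := by
  rcases Nat.eq_zero_or_pos a with rfl | h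
  · simp
    exact ENNReal.rpow_le_rpow (by norm_num) (by linarith)
  · have h1 : (1:ℝ≥0∞) ≤ a := by exact_mod_cast h
    calc (2 + (a:ℝ≥0∞)) ^ q ≤ (3 * a) ^ q := by
          apply ENNReal.rpow_le_rpow _ (by linarith)
          calc 2 + (a:ℝ≥0∞) ≤ 2 * a + a := by
                gcongr
                calc (2:ℝ≥0∞) = 2 * 1 := by simp
                  _ ≤ 2 * a := by gcongr
            _ = 3 * a := by ring
      _ = 3 ^ q * (a:ℝ≥0∞) ^ q := ENNReal.mul_rpow_of_nonneg _ _ (by linarith)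
      _ = 3 ^ q * (a * (a:ℝ≥0∞) ^ (q - 1)) := by
          congr 1
          conv_rhs => rw [← ENNReal.rpow_one (a:ℝ≥0∞), ← ENNReal.rpow_mul,
            ← ENNReal.rpow_add _ _ (by positivity) (by simp)]
          congr 1; ring
      _ ≤ 3 ^ q * (a * (2:ℝ≥0∞) ^ (e * (q - 1))) := by
          gcongr
          rw [ENNReal.rpow_mul, ENNReal.rpow_natCast]
          apply ENNReal.rpow_le_rpow _ (by linarith)
          exact_mod_cast ha
      _ ≤ _ := by gcongr; exact le_add_self

theorem rpow_small (q : ℝ) (hq : q ≤ 1) (a : ℕ) :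
    (2 + (a:ℝ≥0∞)) ^ q ≤ 2 * (1 + a * 1) := by
  calc (2 + (a:ℝ≥0∞)) ^ q ≤ (2 + (a:ℝ≥0∞)) ^ (1:ℝ) :=
        ENNReal.rpow_le_rpow_of_exponent_le (le_add_right (by norm_num)) hq
    _ = 2 * 1 + a := by simp
    _ ≤ 2 * 1 + 2 * a := by
        gcongr
        calc (a:ℝ≥0∞) = 1 * a := by simp
          _ ≤ 2 * a := by gcongr; norm_num
    _ = _ := by ring

theorem small_case (q : ℝ) (hq0 : 0 < q) (hq : q ≤ 1) (j M N : ℕ) (hj : 1 ≤ j) (I : ℕ → ℕ)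
    (hI : StrictMono I) :
    ∫⁻ x, seqJumpCount ((2:ℝ)⁻¹ ^ N) I (fjM j M x) ^ q ∂μX
      ≤ 4 * ((M + 1) * 2 ^ M + 2 ^ (M + j + N)) := by
  refine (lint_bound j M N I hI _ 2 1 ?_ ?_).trans ?_
  · intro x hx
    rw [jump_zero j M N x hx, ENNReal.zero_rpow_of_pos hq0]
  · intro k n p hn hs
    exact (ENNReal.rpow_le_rpow (jump_le j M N k n p hj hn hs I hI) hq0.le).trans
      (rpow_small q hq _)
  · calc (2:ℝ≥0∞) * ((M + 1) * 2 ^ M + 2 * 2 ^ (M + j + N) * 1)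
        ≤ 2 * (2 * ((M + 1) * 2 ^ M) + 2 * 2 ^ (M + j + N) * 1) := by
          refine mul_le_mul_right (add_le_add_left ?_ _) _
          rw [two_mul]; exact le_add_self
      _ = _ := by ring

theorem big_case (q : ℝ) (hq : 1 < q) (j M N : ℕ) (hj : 1 ≤ j) (I : ℕ → ℕ)
    (hI : StrictMono I) :
    ∫⁻ x, seqJumpCount ((2:ℝ)⁻¹ ^ N) I (fjM j M x) ^ q ∂μX
      ≤ 2 * 3 ^ q * ((M + 1) * 2 ^ M + (N + 1) * (2:ℝ≥0∞) ^ ((M : ℝ) + (j + N) * q)) := by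
  have hq0 : 0 < q := by linarith
  refine (lint_bound j M N I hI _ (3 ^ q) (2 ^ (((j + N : ℕ) : ℝ) * (q - 1))) ?_ ?_).trans ?_
  · intro x hx
    rw [jump_zero j M N x hx, ENNReal.zero_rpow_of_pos hq0]
  · intro k n p hn hs
    exact (ENNReal.rpow_le_rpow (jump_le j M N k n p hj hn hs I hI) hq0.le).trans
      (rpow_big q hq _ _ (goodSet_card I hI j N k p))
  · have e : (2:ℝ≥0∞) ^ (M + j + N) * 2 ^ (((j + N : ℕ) : ℝ) * (q - 1)) =
        (2:ℝ≥0∞) ^ ((M : ℝ) + (j + N) * q) := by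
      rw [← ENNReal.rpow_natCast, ← ENNReal.rpow_add _ _ (by simp) (by simp)]
      congr 1
      push_cast
      ring
    rw [mul_assoc 2, e]
    calc (3:ℝ≥0∞) ^ q * ((M + 1) * 2 ^ M + 2 * (2:ℝ≥0∞) ^ ((M : ℝ) + (j + N) * q))
        ≤ 3 ^ q * (2 * ((M + 1) * 2 ^ M) +
            2 * ((N + 1) * (2:ℝ≥0∞) ^ ((M : ℝ) + (j + N) * q))) := by
          refine mul_le_mul_right (add_le_add ?_ (mul_le_mul_right ?_ _)) _
          · rw [two_mul]; exact le_add_self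
          · calc (2:ℝ≥0∞) ^ ((M : ℝ) + (j + N) * q) = 1 * (2:ℝ≥0∞) ^ ((M : ℝ) + (j + N) * q) := by
                  simp
              _ ≤ _ := by gcongr; exact le_add_self
      _ = _ := by ring

/-- Lemma 4.6 of Mirek–Słomian–Szarek: moment estimates for the sequential jump
counting function of `f_{j,M}`. -/
theorem stmt12 (q : ℝ) (hq : 0 < q) :
    ∃ C : ℝ, 0 < C ∧
      ∀ (j M N : ℕ), 1 ≤ j → 1 ≤ M → N ≤ M → ∀ (I : ℕ → ℕ), StrictMono I →
        (1 < q →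
          ∫⁻ x, seqJumpCount ((2:ℝ)⁻¹ ^ N) I (fjM j M x) ^ q ∂μX
            ≤ ENNReal.ofReal C *
              ((M + 1) * 2 ^ M + (N + 1) * (2:ℝ≥0∞) ^ ((M : ℝ) + (j + N) * q))) ∧
        (q = 1 →
          ∫⁻ x, seqJumpCount ((2:ℝ)⁻¹ ^ N) I (fjM j M x) ^ q ∂μX
            ≤ ENNReal.ofReal C *
              ((M + 1) * 2 ^ M + (j + N) * 2 ^ (M + j + N))) ∧
        (q < 1 →
          ∫⁻ x, seqJumpCount ((2:ℝ)⁻¹ ^ N) I (fjM j M x) ^ q ∂μX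
            ≤ ENNReal.ofReal C *
              ((M + 1) * 2 ^ M + 2 ^ (M + j + N))) := by
  refine ⟨4 * 3 ^ q, by positivity, ?_⟩
  intro j M N hj hM hN I hI
  have h3 : (1:ℝ) ≤ 3 ^ q := Real.one_le_rpow (by norm_num) hq.le
  have hC4 : (4:ℝ≥0∞) ≤ ENNReal.ofReal (4 * 3 ^ q) := by
    rw [ENNReal.le_ofReal_iff_toReal_le (by simp) (by positivity)]
    simp
    linarith
  have hC3 : (2:ℝ≥0∞) * 3 ^ q ≤ ENNReal.ofReal (4 * 3 ^ q) := by
    rw [ENNReal.ofReal_mul (by norm_num), ← ENNReal.ofReal_rpow_of_pos (by norm_num)]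
    simp only [ENNReal.ofReal_ofNat]
    gcongr
    norm_num
  refine ⟨fun h => ?_, fun h => ?_, fun h => ?_⟩
  · exact (big_case q h j M N hj I hI).trans (by gcongr)
  · refine (small_case q hq h.le j M N hj I hI).trans ?_
    gcongr
    calc (2:ℝ≥0∞) ^ (M + j + N) = 1 * 2 ^ (M + j + N) := by simp
      _ ≤ _ := by
        gcongr
        exact le_add_right (by exact_mod_cast hj)
  · exact (small_case q hq h.le j M N hj I hI).trans (by gcongr)
end

section
/- With X, μ and f_{j,M} as in the context, for all j, M ∈ ℤ₊, all p ∈ [1,∞) and all r ∈ [1,∞), the quantity L_{j,M} := sup_{λ > 0} ‖λ · (N_λ f_{j,M})^{1/r}‖_{L^{p,∞}(X)} satisfies L_{j,M} ≃ 2^{j/r + M/p} (M+1)^{1/p}, with implicit constants independent of j and M. -/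
open MeasureTheory ENNReal

/-- The `λ`-jump counting function `N_λ(a_t : t ∈ ℕ)`. -/
noncomputable def jumpCount (lam : ℝ) (a : ℕ → ℝ) : ℝ≥0∞ :=
  ⨆ (J : ℕ) (_ : ∃ t : ℕ → ℕ, StrictMonoOn t (Set.Iic J) ∧
      ∀ j < J, lam ≤ |a (t (j+1)) - a (t j)|), (J : ℝ≥0∞)

/-- The weak `L^{p,∞}(X, μX)` quasi-norm of an `ℝ≥0∞`-valued function. -/
noncomputable def weakX (p : ℝ) (g : ℕ × ℕ+ → ℝ≥0∞) : ℝ≥0∞ :=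
  ⨆ (α : ℝ) (_ : 0 < α), ENNReal.ofReal α * μX {x | ENNReal.ofReal α < g x} ^ (1/p)

namespace Jump13

/-- The tent function. -/
noncomputable def tent (u : ℝ) : ℝ := max 0 (min u (2 - u))

/-- The variation function of the tent. -/
noncomputable def tentVar (u : ℝ) : ℝ := min (max u 0) 2

lemma tent_diff {a b : ℝ} (h : a ≤ b) : |tent b - tent a| ≤ tentVar b - tentVar a := by
  unfold tent tentVar
  rw [abs_le]
  constructor <;>
  · rcases max_cases 0 (min a (2 - a)) with h1 | h1 <;>
    rcases max_cases 0 (min b (2 - b)) with h2 | h2 <;>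
    rcases min_cases a (2 - a) with h3 | h3 <;>
    rcases min_cases b (2 - b) with h4 | h4 <;>
    rcases max_cases a 0 with h5 | h5 <;>
    rcases max_cases b 0 with h6 | h6 <;>
    rcases min_cases (max a 0) 2 with h7 | h7 <;>
    rcases min_cases (max b 0) 2 with h8 | h8 <;> linarith

lemma tentVar_nonneg (u : ℝ) : 0 ≤ tentVar u := le_min (le_max_right _ _) (by norm_num)
lemma tentVar_le (u : ℝ) : tentVar u ≤ 2 := min_le_right _ _
lemma tent_nonneg (u : ℝ) : 0 ≤ tent u := le_max_left _ _
lemma tent_le (u : ℝ) : tent u ≤ 1 := by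
  unfold tent
  apply max_le (by norm_num)
  rcases min_cases u (2 - u) with h | h <;> linarith
lemma tent_eq_zero_of_nonpos {u : ℝ} (h : u ≤ 0) : tent u = 0 :=
  max_eq_left ((min_le_left _ _).trans h)
lemma tent_eq_zero_of_two_le {u : ℝ} (h : 2 ≤ u) : tent u = 0 :=
  max_eq_left ((min_le_right _ _).trans (by linarith))
lemma tent_one : tent 1 = 1 := by unfold tent; norm_num

/-- Sum of `K` consecutive tents. -/
noncomputable def saw (K : ℕ) (s : ℝ) : ℝ := ∑ m ∈ Finset.range K, tent (s - 2 * m)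

lemma saw_nonneg (K : ℕ) (s : ℝ) : 0 ≤ saw K s := Finset.sum_nonneg fun _ _ => tent_nonneg _

lemma saw_le (K : ℕ) (s : ℝ) : saw K s ≤ 1 := by
  unfold saw
  induction K with
  | zero => simp
  | succ K ih =>
    rw [Finset.sum_range_succ]
    rcases le_total s (2 * K) with h | h
    · rw [tent_eq_zero_of_nonpos (by linarith)]; linarith
    · rw [Finset.sum_eq_zero]
      · linarith [tent_le (s - 2 * K)]
      · intro m hm
        apply tent_eq_zero_of_two_le
        have : (m : ℝ) + 1 ≤ K := by exact_mod_cast Finset.mem_range.1 hm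
        linarith

lemma saw_even (K q : ℕ) : saw K (2 * q : ℝ) = 0 := by
  apply Finset.sum_eq_zero
  intro m _
  rcases le_or_gt q m with h | h
  · apply tent_eq_zero_of_nonpos
    have : (q : ℝ) ≤ m := by exact_mod_cast h
    linarith
  · apply tent_eq_zero_of_two_le
    have : (m : ℝ) + 1 ≤ q := by exact_mod_cast h
    linarith

lemma saw_odd (K q : ℕ) (h : q < K) : 1 ≤ saw K (2 * q + 1 : ℝ) := by
  have h1 : tent ((2 * q + 1 : ℝ) - 2 * q) = 1 := by rw [add_sub_cancel_left, tent_one]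
  refine h1.symm.le.trans ?_
  exact Finset.single_le_sum (f := fun m : ℕ => tent ((2 * q + 1 : ℝ) - 2 * m))
    (fun _ _ => tent_nonneg _) (Finset.mem_range.2 h)

lemma saw_step (K i : ℕ) (h : i < 2 * K) : 1 ≤ |saw K ((i + 1 : ℕ) : ℝ) - saw K (i : ℝ)| := by
  obtain ⟨q, rfl | rfl⟩ := Nat.even_or_odd' i
  · have e1 := saw_odd K q (by omega)
    have e2 := saw_even K q
    push_cast
    rw [e2, sub_zero]
    exact e1.trans (le_abs_self _)
  · have e1 := saw_odd K q (by omega)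
    have e2 := saw_even K (q + 1)
    have : ((2 * q + 1 + 1 : ℕ) : ℝ) = 2 * (q + 1 : ℕ) := by push_cast; ring
    rw [this, e2, zero_sub, abs_neg]
    push_cast
    exact e1.trans (le_abs_self _)

/-- Variation function of the sum of tents. -/
noncomputable def sawVar (K : ℕ) (s : ℝ) : ℝ := ∑ m ∈ Finset.range K, tentVar (s - 2 * m)

lemma sawVar_nonneg (K : ℕ) (s : ℝ) : 0 ≤ sawVar K s :=
  Finset.sum_nonneg fun _ _ => tentVar_nonneg _

lemma sawVar_le (K : ℕ) (s : ℝ) : sawVar K s ≤ 2 * K := by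
  have := Finset.sum_le_sum (s := Finset.range K) fun m _ => tentVar_le (s - 2 * m)
  simpa [sawVar, mul_comm] using this

lemma saw_diff (K : ℕ) {a b : ℝ} (h : a ≤ b) :
    |saw K b - saw K a| ≤ sawVar K b - sawVar K a := by
  unfold saw sawVar
  rw [← Finset.sum_sub_distrib, ← Finset.sum_sub_distrib]
  exact (Finset.abs_sum_le_sum_abs _ _).trans
    (Finset.sum_le_sum fun m _ => tent_diff (by linarith))

lemma piece (P t c : ℝ) (hP : 0 < P) :
    (t - P * c) * P⁻¹ * Set.indicator (Set.Ico (P * c) (P * (c + 1))) (fun _ => (1:ℝ)) t +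
    (-t + P * (c + 2)) * P⁻¹ *
      Set.indicator (Set.Ico (P * (c + 1)) (P * (c + 2))) (fun _ => (1:ℝ)) t
      = tent (t * P⁻¹ - c) := by
  obtain ⟨u, rfl⟩ : ∃ u, t = P * u := ⟨P⁻¹ * t, by field_simp⟩
  have e1 : (P * u - P * c) * P⁻¹ = u - c := by field_simp
  have e2 : (-(P * u) + P * (c + 2)) * P⁻¹ = c + 2 - u := by field_simp; ring
  have e3 : P * u * P⁻¹ = u := by field_simp
  rw [e1, e2, e3]
  simp only [Set.indicator_apply, Set.mem_Ico, mul_le_mul_iff_right₀ hP, mul_lt_mul_iff_right₀ hP]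
  unfold tent
  split_ifs <;>
  rcases max_cases 0 (min (u - c) (2 - (u - c))) with h1 | h1 <;>
  rcases min_cases (u - c) (2 - (u - c)) with h3 | h3 <;> grind

/-- The support of the family. -/
def supp (M : ℕ) : Set (ℕ × ℕ+) := {x | x.1 ≤ M ∧ (x.2 : ℕ) ≤ 2 ^ (M - x.1)}

lemma fjM_of_mem {j M : ℕ} {x : ℕ × ℕ+} (hx : x ∈ supp M) (t : ℕ) :
    fjM j M x t =
      saw (2 ^ (j - 1)) ((t : ℝ) * ((2:ℝ) ^ x.1)⁻¹ - (((x.2 : ℕ) : ℝ) - 1) * 2 ^ j) := by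
  unfold fjM
  have hx2 : x.1 ≤ M ∧ (x.2 : ℕ) ≤ 2 ^ (M - x.1) := hx
  rw [if_pos hx2, ← Finset.sum_add_distrib]
  unfold saw
  apply Finset.sum_congr rfl
  intro m _
  have := piece ((2:ℝ) ^ x.1) t ((((x.2 : ℕ) : ℝ) - 1) * 2 ^ j + 2 * m) (by positivity)
  rw [inv_pow, this]
  congr 1
  ring

lemma fjM_of_notMem {j M : ℕ} {x : ℕ × ℕ+} (hx : x ∉ supp M) (t : ℕ) : fjM j M x t = 0 := by
  unfold fjM
  exact if_neg hx

lemma jump_zero {lam : ℝ} {a : ℕ → ℝ} (h : ∀ s t, |a s - a t| < lam) : jumpCount lam a = 0 := by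
  unfold jumpCount
  simp only [ENNReal.iSup_eq_zero]
  rintro J ⟨t, -, ht⟩
  rcases Nat.eq_zero_or_pos J with rfl | hJ
  · simp
  · exact absurd (ht 0 hJ) (not_le.2 (h _ _))

lemma two_pow_pred {j : ℕ} (hj : 1 ≤ j) : 2 * 2 ^ (j - 1) = 2 ^ j := by
  rw [← pow_succ', Nat.sub_add_cancel hj]

lemma jump_le {j M : ℕ} (hj : 1 ≤ j) {x : ℕ × ℕ+} (hx : x ∈ supp M) {lam : ℝ} (hl : 0 < lam) :
    jumpCount lam (fjM j M x) ≤ ENNReal.ofReal (2 ^ j / lam) := by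
  unfold jumpCount
  refine iSup_le fun J => iSup_le ?_
  rintro ⟨t, hm, ht⟩
  rw [← ENNReal.ofReal_natCast]
  apply ENNReal.ofReal_le_ofReal
  rw [le_div_iff₀ hl]
  set V : ℕ → ℝ := fun i => sawVar (2 ^ (j - 1))
    ((t i : ℝ) * ((2:ℝ) ^ x.1)⁻¹ - (((x.2 : ℕ) : ℝ) - 1) * 2 ^ j) with hV
  have h1 : ∑ i ∈ Finset.range J, lam ≤ ∑ i ∈ Finset.range J, (V (i + 1) - V i) := by
    apply Finset.sum_le_sum
    intro i hi
    have hi := Finset.mem_range.1 hi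
    refine (ht i hi).trans ?_
    rw [fjM_of_mem hx, fjM_of_mem hx]
    apply saw_diff
    have h2 : t i ≤ t (i + 1) :=
      (hm (Set.mem_Iic.2 hi.le) (Set.mem_Iic.2 hi) (Nat.lt_succ_self i)).le
    have h3 : (t i : ℝ) ≤ t (i + 1) := by exact_mod_cast h2
    gcongr
  rw [Finset.sum_range_sub] at h1
  have h4 : V J ≤ 2 * (2 ^ (j - 1) : ℕ) := sawVar_le _ _
  have h5 : 0 ≤ V 0 := sawVar_nonneg _ _
  have h6 : (2 * (2 ^ (j - 1) : ℕ) : ℝ) = 2 ^ j := by exact_mod_cast two_pow_pred hj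
  simp at h1
  linarith

lemma le_jump {j M : ℕ} (hj : 1 ≤ j) {x : ℕ × ℕ+} (hx : x ∈ supp M) :
    2 ^ j ≤ jumpCount 1 (fjM j M x) := by
  unfold jumpCount
  refine le_trans (by simp) (le_iSup₂_of_le (2 ^ j) ?_ (le_refl _))
  refine ⟨fun i => 2 ^ x.1 * (((x.2 : ℕ) - 1) * 2 ^ j + i), ?_, ?_⟩
  · apply StrictMono.strictMonoOn
    intro a b hab
    have : 0 < 2 ^ x.1 := by positivity
    dsimp only
    gcongr
  · intro i hi
    have key : ∀ i : ℕ, ((2 ^ x.1 * (((x.2 : ℕ) - 1) * 2 ^ j + i) : ℕ) : ℝ) * ((2:ℝ) ^ x.1)⁻¹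
        - (((x.2 : ℕ) : ℝ) - 1) * 2 ^ j = (i : ℝ) := by
      intro i
      have : 1 ≤ (x.2 : ℕ) := x.2.pos
      push_cast [this]
      field_simp
      ring
    rw [fjM_of_mem hx, fjM_of_mem hx, key, key]
    apply saw_step
    rwa [two_pow_pred hj]

lemma mu_supp (M : ℕ) : μX (supp M) = 2 ^ M * ((M : ℝ≥0∞) + 1) := by
  have hms : MeasurableSet (supp M) := (Set.to_countable _).measurableSet
  unfold μX
  rw [withDensity_apply _ hms, ← lintegral_indicator hms, lintegral_count,
    ENNReal.tsum_prod (f := fun k n => (supp M).indicator (fun x => (2:ℝ≥0∞) ^ x.1) (k, n))]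
  have h1 : ∀ k : ℕ, ∑' n : ℕ+, (supp M).indicator (fun x => (2:ℝ≥0∞) ^ x.1) (k, n)
      = if k ≤ M then 2 ^ M else 0 := by
    intro k
    split_ifs with hk
    · have h2 : ∀ n : ℕ+, (supp M).indicator (fun x => (2:ℝ≥0∞) ^ x.1) (k, n)
          = (fun n : ℕ => if n < 2 ^ (M - k) then (2:ℝ≥0∞) ^ k else 0) (Equiv.pnatEquivNat n) := by
        intro n
        have e : (Equiv.pnatEquivNat n : ℕ) + 1 = (n : ℕ) := PNat.natPred_add_one n
        simp only [Set.indicator_apply, supp, Set.mem_ofPred_eq, hk, true_and]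
        congr 1
        rw [← e, Nat.succ_le_iff]
      simp_rw [h2]
      rw [Equiv.tsum_eq Equiv.pnatEquivNat (fun n : ℕ => if n < 2 ^ (M - k) then (2:ℝ≥0∞) ^ k else 0),
        tsum_eq_sum (s := Finset.range (2 ^ (M - k)))]
      · rw [Finset.sum_congr rfl fun n hn => if_pos (Finset.mem_range.1 hn)]
        simp
        rw [← pow_add, Nat.sub_add_cancel hk]
      · intro n hn
        simpa using hn
    · rw [ENNReal.tsum_eq_zero]
      intro n
      apply Set.indicator_of_notMem
      intro h
      exact hk h.1
  simp_rw [h1]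
  rw [tsum_eq_sum (s := Finset.range (M + 1))]
  · rw [Finset.sum_congr rfl fun n hn => if_pos (Nat.lt_succ_iff.1 (Finset.mem_range.1 hn))]
    simp [mul_comm]
  · intro n hn
    simp at hn
    exact if_neg (by omega)

lemma rhs_eq (p r : ℝ) (hp : 1 ≤ p) (j M : ℕ) :
    (2:ℝ≥0∞) ^ ((j : ℝ)/r + (M : ℝ)/p) * ((M : ℝ≥0∞) + 1) ^ (1/p)
      = ENNReal.ofReal (2 ^ ((j : ℝ)/r)) * μX (supp M) ^ (1/p) := by
  rw [mu_supp, ENNReal.mul_rpow_of_nonneg _ _ (by positivity),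
    ENNReal.rpow_add _ _ (by simp) (by simp), ← ENNReal.rpow_natCast, ← ENNReal.rpow_mul, mul_assoc,
    ← ENNReal.ofReal_rpow_of_pos (by norm_num)]
  simp [div_eq_mul_inv]

lemma g_le (r : ℝ) (hr : 1 ≤ r) {j M : ℕ} (hj : 1 ≤ j) (x : ℕ × ℕ+) {lam : ℝ} (hl : 0 < lam) :
    ENNReal.ofReal lam * jumpCount lam (fjM j M x) ^ (1/r) ≤
      (supp M).indicator (fun _ => ENNReal.ofReal (2 ^ ((j : ℝ)/r))) x := by
  have hr0 : 0 < 1 / r := by positivity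
  by_cases hx : x ∈ supp M
  · rw [Set.indicator_of_mem hx]
    rcases lt_or_ge 1 lam with h1 | h1
    · rw [jump_zero]
      · simp [ENNReal.zero_rpow_of_pos, show 0 < r by linarith]
      · intro s t
        rw [fjM_of_mem hx, fjM_of_mem hx]
        refine lt_of_le_of_lt ?_ h1
        rw [abs_le]
        constructor <;> linarith [saw_nonneg (2 ^ (j - 1)) ((s : ℝ) * ((2:ℝ) ^ x.1)⁻¹ - (((x.2 : ℕ) : ℝ) - 1) * 2 ^ j),
          saw_le (2 ^ (j - 1)) ((s : ℝ) * ((2:ℝ) ^ x.1)⁻¹ - (((x.2 : ℕ) : ℝ) - 1) * 2 ^ j),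
          saw_nonneg (2 ^ (j - 1)) ((t : ℝ) * ((2:ℝ) ^ x.1)⁻¹ - (((x.2 : ℕ) : ℝ) - 1) * 2 ^ j),
          saw_le (2 ^ (j - 1)) ((t : ℝ) * ((2:ℝ) ^ x.1)⁻¹ - (((x.2 : ℕ) : ℝ) - 1) * 2 ^ j)]
    · calc _ ≤ ENNReal.ofReal lam * ENNReal.ofReal (2 ^ j / lam) ^ (1/r) := by
            gcongr
            exact jump_le hj hx hl
        _ = ENNReal.ofReal (lam * (2 ^ j / lam) ^ (1/r)) := by
            rw [ENNReal.ofReal_rpow_of_pos (by positivity), ENNReal.ofReal_mul hl.le]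
        _ ≤ _ := by
            apply ENNReal.ofReal_le_ofReal
            rw [Real.div_rpow (by positivity) hl.le, ← Real.rpow_natCast, ← Real.rpow_mul (by norm_num),
              mul_one_div, mul_div_left_comm]
            apply mul_le_of_le_one_right (by positivity)
            rw [div_le_one (by positivity)]
            exact Real.self_le_rpow_of_le_one hl.le h1 (by rw [div_le_one (by linarith)]; exact hr)
  · rw [Set.indicator_of_notMem hx, jump_zero]
    · simp [ENNReal.zero_rpow_of_pos, show 0 < r by linarith]
    · intro s t
      simpa [fjM_of_notMem hx] using hl

end Jump13

/-- The two-sided estimate (4.11) of Mirek–Słomian–Szarek for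
`L_{j,M} = sup_{λ>0} ‖λ (N_λ f_{j,M})^{1/r}‖_{L^{p,∞}(X)}`. -/
theorem stmt13 (p r : ℝ) (hp : 1 ≤ p) (hr : 1 ≤ r) :
    ∃ c C : ℝ, 0 < c ∧ 0 < C ∧
      ∀ j M : ℕ, 1 ≤ j → 1 ≤ M →
        ENNReal.ofReal c *
            ((2:ℝ≥0∞) ^ ((j : ℝ)/r + (M : ℝ)/p) * ((M : ℝ≥0∞) + 1) ^ (1/p))
          ≤ (⨆ (lam : ℝ) (_ : 0 < lam),
              weakX p (fun x => ENNReal.ofReal lam * jumpCount lam (fjM j M x) ^ (1/r))) ∧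
        (⨆ (lam : ℝ) (_ : 0 < lam),
            weakX p (fun x => ENNReal.ofReal lam * jumpCount lam (fjM j M x) ^ (1/r)))
          ≤ ENNReal.ofReal C *
            ((2:ℝ≥0∞) ^ ((j : ℝ)/r + (M : ℝ)/p) * ((M : ℝ≥0∞) + 1) ^ (1/p)) := by
  refine ⟨1/2, 1, by norm_num, by norm_num, fun j M hj _ => ?_⟩
  have hr0 : 0 < 1 / r := by positivity
  have hp0 : 0 < 1 / p := by positivity
  rw [Jump13.rhs_eq p r hp]
  constructor
  · refine le_iSup₂_of_le 1 one_pos ?_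
    unfold weakX
    refine le_iSup₂_of_le (1 / 2 * 2 ^ ((j : ℝ) / r)) (by positivity) ?_
    rw [ENNReal.ofReal_mul (by norm_num), mul_assoc]
    gcongr
    intro x hx
    have h1 := ENNReal.rpow_le_rpow (Jump13.le_jump hj hx) hr0.le
    rw [Set.mem_ofPred_eq, ENNReal.ofReal_one]
    dsimp only
    rw [one_mul]
    refine lt_of_lt_of_le ?_ h1
    rw [← ENNReal.rpow_natCast, ← ENNReal.rpow_mul, mul_one_div,
      ← ENNReal.ofReal_mul (by norm_num)]
    have : (2:ℝ≥0∞) ^ ((j : ℝ) / r) = ENNReal.ofReal (2 ^ ((j : ℝ) / r)) := by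
      rw [← ENNReal.ofReal_rpow_of_pos (by norm_num)]; simp
    rw [this]
    have h2 : (0:ℝ) < 2 ^ ((j : ℝ) / r) := by positivity
    exact (ENNReal.ofReal_lt_ofReal_iff h2).2 (by linarith)
  · refine iSup₂_le fun lam hl => ?_
    unfold weakX
    refine iSup₂_le fun α hα => ?_
    rw [ENNReal.ofReal_one, one_mul]
    rcases le_or_gt (2 ^ ((j : ℝ) / r)) α with h | h
    · have : {x | ENNReal.ofReal α < ENNReal.ofReal lam * jumpCount lam (fjM j M x) ^ (1/r)}
          = ∅ := by
        ext x
        simp only [Set.mem_ofPred_eq, Set.mem_empty_iff_false, iff_false, not_lt]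
        refine (Jump13.g_le r hr hj x hl).trans ?_
        exact (Set.indicator_le_self' (by simp) x).trans (ENNReal.ofReal_le_ofReal h)
      rw [this, measure_empty, ENNReal.zero_rpow_of_pos hp0, mul_zero]
      exact zero_le
    · gcongr
      intro x hx
      by_contra hxs
      have h3 := Jump13.g_le r hr hj x hl (M := M)
      rw [Set.indicator_of_notMem hxs] at h3
      exact absurd (lt_of_lt_of_le hx h3) _root_.not_lt_zero
end

section
/- Let (a_t(x) : t ∈ ℝ) ⊆ ℂ be a family of measurable functions on a σ-finite measure space (X, 𝓑(X), μ), let 𝕀 ⊆ ℝ have at least two elements, and assume t ↦ a_t(x) is continuous for μ-a.e. x or 𝕀 is countable. Then for every p ∈ [1,∞) and r ∈ [1,∞): ‖sup_{t ∈ 𝕀 ∖ {sup 𝕀}} |a_t|‖_{L^p(X)} ≤ sup_{t ∈ 𝕀} ‖a_t‖_{L^p(X)} + sup_{N ∈ ℤ₊} sup_{I ∈ 𝔖_N(𝕀)} ‖O^r_{I,N}(a_t : t ∈ 𝕀)‖_{L^p(X)}. In words, oscillations always dominate maximal functions. -/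
open MeasureTheory ENNReal

/-- Finite subfamilies are controlled. -/
theorem fin_bound (p r : ℝ) (hp : 1 ≤ p) (hr : 1 ≤ r)
    (X : Type) [MeasurableSpace X] (μ : Measure X)
    (a : ℝ → X → ℂ) (hmeas : ∀ t, Measurable (a t))
    (𝕀 : Set ℝ) (F : Finset ℝ) (hF : ∀ t ∈ F, t ∈ {s ∈ 𝕀 | ∃ u ∈ 𝕀, s < u}) :
    (∫⁻ x, (⨆ t ∈ F, ENNReal.ofReal ‖a t x‖) ^ p ∂μ) ^ (1/p)
      ≤ (⨆ t ∈ 𝕀, eLpNorm (a t) (ENNReal.ofReal p) μ)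
        + ⨆ (N : ℕ) (_ : 0 < N) (I : ℕ → ℝ) (_ : ∀ i, i ≤ N → I i ∈ 𝕀)
            (_ : ∀ i i', i < i' → i' ≤ N → I i < I i'),
          (∫⁻ x, ((∑ jj ∈ Finset.range N,
              (⨆ t ∈ Set.Ico (I jj) (I (jj+1)) ∩ 𝕀,
                ENNReal.ofReal ‖a t x - a (I jj) x‖) ^ r) ^ (1/r)) ^ p ∂μ) ^ (1/p) := by
  have hp0 : 0 < p := by linarith
  have hr0 : 0 < r := by linarith
  rcases F.eq_empty_or_nonempty with rfl | hne
  · simp [hp0]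
  obtain ⟨s, hs, hmin⟩ := F.exists_min_image id hne
  obtain ⟨m, hm, hmax⟩ := F.exists_max_image id hne
  obtain ⟨hmI, u, hu, hmu⟩ := hF m hm
  have hsI := (hF s hs).1
  have hsu : s < u := lt_of_le_of_lt (hmax s hs) hmu
  have hsub : ∀ t ∈ F, t ∈ Set.Ico s u ∩ 𝕀 := fun t ht =>
    ⟨⟨hmin t ht, lt_of_le_of_lt (hmax t ht) hmu⟩, (hF t ht).1⟩
  have e1 : (∫⁻ x, (ENNReal.ofReal ‖a s x‖) ^ p ∂μ) ^ (1/p)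
      = eLpNorm (a s) (ENNReal.ofReal p) μ := by
    rw [eLpNorm_eq_lintegral_rpow_enorm_toReal (by simpa using hp0) (by simp)]
    simp [ENNReal.toReal_ofReal hp0.le, ofReal_norm_eq_enorm]
  calc (∫⁻ x, (⨆ t ∈ F, ENNReal.ofReal ‖a t x‖) ^ p ∂μ) ^ (1/p)
      ≤ (∫⁻ x, ((fun x => ENNReal.ofReal ‖a s x‖)
          + (fun x => ⨆ t ∈ F, ENNReal.ofReal ‖a t x - a s x‖)) x ^ p ∂μ) ^ (1/p) := by
        gcongr with x
        simp only [Pi.add_apply]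
        refine iSup₂_le fun t ht => ?_
        refine le_trans ?_ (add_le_add_right
          (le_iSup₂ (f := fun t (_ : t ∈ F) => ENNReal.ofReal ‖a t x - a s x‖) t ht) _)
        rw [← ENNReal.ofReal_add (norm_nonneg _) (norm_nonneg _)]
        refine ENNReal.ofReal_le_ofReal ?_
        simpa using norm_add_le (a s x) (a t x - a s x)
    _ ≤ (∫⁻ x, (ENNReal.ofReal ‖a s x‖) ^ p ∂μ) ^ (1/p)
        + (∫⁻ x, (⨆ t ∈ F, ENNReal.ofReal ‖a t x - a s x‖) ^ p ∂μ) ^ (1/p) := by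
        refine ENNReal.lintegral_Lp_add_le ?_ ?_ hp
        · exact (hmeas s).norm.ennreal_ofReal.aemeasurable
        · exact (Measurable.biSup _ F.countable_toSet
            fun t _ => ((hmeas t).sub (hmeas s)).norm.ennreal_ofReal).aemeasurable
    _ ≤ _ := by
        refine add_le_add ?_ ?_
        · rw [e1]
          exact le_iSup₂ (f := fun t (_ : t ∈ 𝕀) => eLpNorm (a t) (ENNReal.ofReal p) μ) s hsI
        · refine le_trans ?_ (le_iSup₂_of_le 1 one_pos (le_iSup_of_le
            (fun i => if i = 0 then s else u) (le_iSup₂_of_le ?_ ?_ le_rfl)))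
          · gcongr with x
            simp only [Finset.sum_range_one]
            rw [← ENNReal.rpow_mul, mul_one_div_cancel hr0.ne', ENNReal.rpow_one]
            simp only [if_true, zero_add, one_ne_zero, if_false]
            exact iSup₂_le fun t ht => le_iSup₂
              (f := fun t (_ : t ∈ Set.Ico s u ∩ 𝕀) => ENNReal.ofReal ‖a t x - a s x‖)
              t (hsub t ht)
          · intro i _
            dsimp only
            split_ifs <;> assumption
          · intro i i' h h'
            have h1 : i = 0 := by omega
            have h2 : i' ≠ 0 := by omega
            simp [h1, h2, hsu]

/-- Reduction of the supremum to a countable subfamily. -/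
theorem exists_ctble (X : Type) [MeasurableSpace X] (μ : Measure X)
    (a : ℝ → X → ℂ) (S : Set ℝ)
    (hreg : (∀ᵐ x ∂μ, Continuous fun t => a t x) ∨ S.Countable) :
    ∃ D : Set ℝ, D.Countable ∧ D ⊆ S ∧ ∀ᵐ x ∂μ,
      (⨆ t ∈ S, ENNReal.ofReal ‖a t x‖) ≤ ⨆ t ∈ D, ENNReal.ofReal ‖a t x‖ := by
  rcases hreg with h | h
  · obtain ⟨D, hDS, hD, hSD⟩ := TopologicalSpace.IsSeparable.exists_countable_dense_subset
      (TopologicalSpace.IsSeparable.of_separableSpace S)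
    refine ⟨D, hD, hDS, ?_⟩
    filter_upwards [h] with x hx
    refine iSup₂_le fun t ht => ?_
    have hcl : IsClosed {t | ENNReal.ofReal ‖a t x‖ ≤ ⨆ t ∈ D, ENNReal.ofReal ‖a t x‖} :=
      isClosed_le (ENNReal.continuous_ofReal.comp hx.norm) continuous_const
    exact closure_minimal (fun t ht => le_iSup₂
      (f := fun t (_ : t ∈ D) => ENNReal.ofReal ‖a t x‖) t ht) hcl (hSD ht)
  · exact ⟨S, h, le_rfl, by simp⟩

/-- Remark 2.1(3) of Mirek–Słomian–Szarek: oscillations dominate maximal functions. -/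
theorem stmt14 (p r : ℝ) (hp : 1 ≤ p) (hr : 1 ≤ r)
    (X : Type) [MeasurableSpace X] (μ : Measure X) [SigmaFinite μ]
    (a : ℝ → X → ℂ) (hmeas : ∀ t, Measurable (a t))
    (𝕀 : Set ℝ) (h𝕀 : 𝕀.Nontrivial)
    (hreg : (∀ᵐ x ∂μ, Continuous fun t => a t x) ∨ 𝕀.Countable) :
    (∫⁻ x, (⨆ t ∈ {s ∈ 𝕀 | ∃ u ∈ 𝕀, s < u}, ENNReal.ofReal ‖a t x‖) ^ p ∂μ) ^ (1/p)
      ≤ (⨆ t ∈ 𝕀, eLpNorm (a t) (ENNReal.ofReal p) μ)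
        + ⨆ (N : ℕ) (_ : 0 < N) (I : ℕ → ℝ) (_ : ∀ i, i ≤ N → I i ∈ 𝕀)
            (_ : ∀ i i', i < i' → i' ≤ N → I i < I i'),
          (∫⁻ x, ((∑ jj ∈ Finset.range N,
              (⨆ t ∈ Set.Ico (I jj) (I (jj+1)) ∩ 𝕀,
                ENNReal.ofReal ‖a t x - a (I jj) x‖) ^ r) ^ (1/r)) ^ p ∂μ) ^ (1/p) := by
  have hp0 : 0 < p := by linarith
  obtain ⟨D, hD, hDS, hae⟩ := exists_ctble X μ a {s ∈ 𝕀 | ∃ u ∈ 𝕀, s < u}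
    (hreg.imp id fun h => h.mono fun t ht => ht.1)
  have : Countable D := hD.to_subtype
  rw [one_div, ENNReal.rpow_inv_le_iff hp0, ← one_div]
  calc ∫⁻ x, (⨆ t ∈ {s ∈ 𝕀 | ∃ u ∈ 𝕀, s < u}, ENNReal.ofReal ‖a t x‖) ^ p ∂μ
      ≤ ∫⁻ x, ⨆ F : Finset D,
        (⨆ t ∈ F.map (Function.Embedding.subtype (· ∈ D)), ENNReal.ofReal ‖a t x‖) ^ p ∂μ := by
        refine lintegral_mono_ae ?_
        filter_upwards [hae] with x hx
        rw [← ENNReal.le_rpow_inv_iff hp0]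
        refine hx.trans (iSup₂_le fun t ht => ?_)
        rw [ENNReal.le_rpow_inv_iff hp0]
        refine le_iSup_of_le {⟨t, ht⟩} ?_
        simp
    _ = ⨆ F : Finset D, ∫⁻ x,
        (⨆ t ∈ F.map (Function.Embedding.subtype (· ∈ D)), ENNReal.ofReal ‖a t x‖) ^ p ∂μ := by
        refine lintegral_iSup_directed (fun F => ?_) ?_
        · exact ((Measurable.biSup _ (Finset.countable_toSet _)
            fun t _ => (hmeas t).norm.ennreal_ofReal).pow_const p).aemeasurable
        · refine Monotone.directed_le fun F G h x => ?_
          refine ENNReal.rpow_le_rpow (biSup_mono fun t ht => ?_) hp0.le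
          exact Finset.map_subset_map.2 h ht
    _ ≤ _ := by
        refine iSup_le fun F => ?_
        rw [← ENNReal.rpow_inv_le_iff hp0, ← one_div]
        refine fin_bound p r hp hr X μ a hmeas 𝕀 _ fun t ht => hDS ?_
        obtain ⟨y, _, rfl⟩ := Finset.mem_map.1 ht
        exact y.2
end

section
/- Let (a_t(x) : t ∈ ℝ) ⊆ ℂ be a family of measurable functions on a σ-finite measure space (X, 𝓑(X), μ) such that t ↦ a_t(x) is continuous for μ-a.e. x ∈ X. Suppose there are p ∈ [1,∞), r ∈ [1,∞) and a finite constant C_{p,r} > 0 such that sup_{N ∈ ℤ₊} sup_{I ∈ 𝔖_N(ℝ₊)} ‖O^r_{I,N}(a_t : t ∈ ℝ₊)‖_{L^p(X)} ≤ C_{p,r}. Then the limit lim_{t → ∞} a_t(x) exists for μ-almost every x ∈ X. -/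
open MeasureTheory ENNReal

theorem aux_det (f : ℝ → ℂ) (hf : Continuous f)
    (h : ∀ k : ℕ, ∃ m : ℕ, ∀ q : ℚ, (m:ℝ) ≤ q → ‖f q - f m‖ ≤ 1 / ((k:ℝ) + 1)) :
    ∃ L : ℂ, Filter.Tendsto f Filter.atTop (nhds L) := by
  apply cauchySeq_tendsto_of_complete
  rw [Metric.cauchySeq_iff']
  intro ε hε
  obtain ⟨k, hk⟩ := exists_nat_one_div_lt hε
  obtain ⟨m, hm⟩ := h k
  refine ⟨m, fun t ht => ?_⟩
  rw [dist_eq_norm]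
  refine lt_of_le_of_lt ?_ hk
  by_contra hcon
  push Not at hcon
  have hop : IsOpen {s : ℝ | 1 / ((k:ℝ) + 1) < ‖f s - f m‖} :=
    isOpen_lt continuous_const (by fun_prop)
  obtain ⟨e, he, hball⟩ := Metric.isOpen_iff.1 hop t hcon
  obtain ⟨q, hq1, hq2⟩ := exists_rat_btwn (show t < t + e by linarith)
  have : (q:ℝ) ∈ Metric.ball t e := by
    rw [Metric.mem_ball, Real.dist_eq, abs_lt]; constructor <;> linarith
  have h1 := hball this
  have h2 := hm q (le_trans ht hq1.le)
  simp only [Set.mem_setOf_eq] at h1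
  linarith

/-- rational oscillation -/
noncomputable def gosc {X : Type} (a : ℝ → X → ℂ) (m n : ℕ) (x : X) : ℝ≥0∞ :=
  ⨆ q : ℚ, ⨆ (_ : (m:ℝ) ≤ q ∧ (q:ℝ) < n), ENNReal.ofReal ‖a q x - a m x‖

theorem gosc_meas {X : Type} [MeasurableSpace X] (a : ℝ → X → ℂ) (hmeas : ∀ t, Measurable (a t))
    (m n : ℕ) : Measurable (gosc a m n) := by
  unfold gosc
  refine Measurable.iSup fun q => Measurable.iSup fun _ => ?_
  exact (((hmeas q).sub (hmeas m)).norm).ennreal_ofReal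

theorem aux_fin {X : Type} [MeasurableSpace X] (μ : Measure X)
    (a : ℝ → X → ℂ) (hmeas : ∀ t, Measurable (a t)) (p r : ℝ) (hp : 1 ≤ p) (hr : 1 ≤ r)
    (C : ℝ) 
    (hosc : ∀ (N : ℕ), 0 < N → ∀ (I : ℕ → ℝ), (∀ i, i ≤ N → I i ∈ Set.Ioi (0:ℝ)) →
      (∀ i i', i < i' → i' ≤ N → I i < I i') →
      (∫⁻ x, ((∑ jj ∈ Finset.range N,
          (⨆ t ∈ Set.Ico (I jj) (I (jj+1)) ∩ Set.Ioi (0:ℝ),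
            ENNReal.ofReal ‖a t x - a (I jj) x‖) ^ r) ^ (1/r)) ^ p ∂μ) ^ (1/p)
        ≤ ENNReal.ofReal C)
    (I : ℕ → ℕ) (hI0 : ∀ i, 0 < I i) (hI : StrictMono I) :
    ∀ᵐ x ∂μ, Filter.Tendsto (fun j => gosc a (I j) (I (j+1)) x) Filter.atTop (nhds 0) := by
  have hp0 : 0 < p := by linarith
  have hr0 : 0 < r := by linarith
  set S : ℕ → X → ℝ≥0∞ := fun N x =>
    ((∑ j ∈ Finset.range N, gosc a (I j) (I (j+1)) x ^ r) ^ (1/r)) ^ p with hS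
  have hSm : ∀ N, Measurable (S N) := fun N =>
    ((Finset.measurable_sum _ fun j _ => (gosc_meas a hmeas _ _).pow_const r).pow_const _).pow_const _
  have hSmono : Monotone S := by
    intro N M hNM x
    refine ENNReal.rpow_le_rpow (ENNReal.rpow_le_rpow ?_ (by positivity)) hp0.le
    exact Finset.sum_le_sum_of_subset (Finset.range_mono hNM)
  have hSb : ∀ N, ∫⁻ x, S N x ∂μ ≤ ENNReal.ofReal C ^ p := by
    intro N
    refine le_trans (lintegral_mono (hSmono (Nat.le_succ N))) ?_
    have h := hosc (N+1) (Nat.succ_pos N) (fun i => (I i : ℝ))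
      (fun i _ => by simpa using hI0 i) (fun i i' h _ => by exact_mod_cast hI h)
    rw [one_div p, ENNReal.rpow_inv_le_iff hp0] at h
    refine le_trans (lintegral_mono fun x => ?_) h
    refine ENNReal.rpow_le_rpow (ENNReal.rpow_le_rpow ?_ (by positivity)) hp0.le
    refine Finset.sum_le_sum fun j _ => ENNReal.rpow_le_rpow ?_ hr0.le
    refine iSup_le fun q => iSup_le fun hq => ?_
    have hpos : (0:ℝ) < I j := by exact_mod_cast hI0 j
    exact le_iSup₂_of_le (q:ℝ) ⟨hq, lt_of_lt_of_le hpos hq.1⟩ le_rfl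
  have hint : ∫⁻ x, ⨆ N, S N x ∂μ ≠ ∞ := by
    rw [lintegral_iSup hSm hSmono]
    exact ne_top_of_le_ne_top (ENNReal.rpow_ne_top_of_nonneg hp0.le ENNReal.ofReal_ne_top)
      (iSup_le hSb)
  filter_upwards [ae_lt_top (Measurable.iSup hSm) hint] with x hx
  set K := ⨆ N, S N x
  have hle : ∀ N, ∑ j ∈ Finset.range N, gosc a (I j) (I (j+1)) x ^ r ≤ (K ^ p⁻¹) ^ r := by
    intro N
    have h1 : S N x ≤ K := le_iSup (fun N => S N x) N
    rw [← ENNReal.rpow_inv_le_iff hr0, ENNReal.le_rpow_inv_iff hp0]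
    simpa [hS] using h1
  have hts : ∑' j, gosc a (I j) (I (j+1)) x ^ r ≠ ∞ := by
    refine ne_top_of_le_ne_top ?_ (ENNReal.tsum_le_of_sum_range_le hle)
    exact ENNReal.rpow_ne_top_of_nonneg hr0.le
      (ENNReal.rpow_ne_top_of_nonneg (by positivity) hx.ne)
  have h0 := ENNReal.tendsto_atTop_zero_of_tsum_ne_top hts
  have h2 := h0.ennrpow_const r⁻¹
  rw [ENNReal.zero_rpow_of_pos (by positivity)] at h2
  simpa [← ENNReal.rpow_mul, mul_inv_cancel₀ hr0.ne'] using h2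

/-- bad set -/
def badset {X : Type} (a : ℝ → X → ℂ) (δ : ℝ) (m n : ℕ) : Set X :=
  {x | (∃ q : ℚ, (m:ℝ) ≤ q ∧ δ < ‖a q x - a m x‖) ∧ gosc a m n x ≤ ENNReal.ofReal δ}

theorem aux_bad {X : Type} [MeasurableSpace X] (ν : Measure X) [IsFiniteMeasure ν]
    (a : ℝ → X → ℂ) (hmeas : ∀ t, Measurable (a t)) (δ : ℝ) (hδ : 0 < δ) (m : ℕ) :
    ∃ n : ℕ, m < n ∧ ν (badset a δ m n) ≤ (2⁻¹ : ℝ≥0∞) ^ m := by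
  have hE : MeasurableSet {x | ∃ q : ℚ, (m:ℝ) ≤ q ∧ δ < ‖a q x - a m x‖} := by
    simp only [Set.setOf_exists]
    refine MeasurableSet.iUnion fun q => ?_
    exact (MeasurableSet.const _).inter
      (measurableSet_lt measurable_const ((hmeas q).sub (hmeas m)).norm)
  have hB : ∀ n, MeasurableSet (badset a δ m n) := fun n =>
    hE.inter (measurableSet_le (gosc_meas a hmeas m n) measurable_const)
  have hanti : Antitone (badset a δ m) := by
    intro n n' h x hx
    refine ⟨hx.1, le_trans ?_ hx.2⟩
    refine iSup_le fun q => iSup_le fun hq => ?_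
    exact le_iSup₂_of_le q ⟨hq.1, lt_of_lt_of_le hq.2 (by exact_mod_cast h)⟩ le_rfl
  have hempty : ⋂ n, badset a δ m n = ∅ := by
    rw [Set.eq_empty_iff_forall_notMem]
    intro x hx
    rw [Set.mem_iInter] at hx
    obtain ⟨q, hq, hq2⟩ := (hx 0).1
    obtain ⟨n, hn⟩ := exists_nat_gt (q:ℝ)
    have h1 : ENNReal.ofReal ‖a q x - a m x‖ ≤ gosc a m n x :=
      le_iSup₂_of_le (f := fun (q : ℚ) (_ : (m:ℝ) ≤ q ∧ (q:ℝ) < n) =>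
        ENNReal.ofReal ‖a q x - a m x‖) q ⟨hq, hn⟩ le_rfl
    have h2 := (ENNReal.ofReal_le_ofReal_iff hδ.le).1 (h1.trans (hx n).2)
    linarith
  have ht := tendsto_measure_iInter_atTop (μ := ν) (fun n => (hB n).nullMeasurableSet) hanti
    ⟨0, measure_ne_top _ _⟩
  rw [hempty, measure_empty] at ht
  have hpos : (0:ℝ≥0∞) < (2⁻¹ : ℝ≥0∞) ^ m := ENNReal.pow_pos (by simp) m
  obtain ⟨n, hn, hn2⟩ := ((ht.eventually_lt_const hpos).and (Filter.eventually_gt_atTop m)).exists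
  exact ⟨n, hn2, hn.le⟩

/-- Remark 2.1(4) of Mirek–Słomian–Szarek: uniform oscillation estimates imply
pointwise almost everywhere convergence as `t → ∞`. -/
theorem stmt15 (p r : ℝ) (hp : 1 ≤ p) (hr : 1 ≤ r)
    (X : Type) [MeasurableSpace X] (μ : Measure X) [SigmaFinite μ]
    (a : ℝ → X → ℂ) (hmeas : ∀ t, Measurable (a t))
    (hcont : ∀ᵐ x ∂μ, Continuous fun t => a t x)
    (C : ℝ) (hC : 0 < C)
    (hosc : ∀ (N : ℕ), 0 < N → ∀ (I : ℕ → ℝ), (∀ i, i ≤ N → I i ∈ Set.Ioi (0:ℝ)) →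
      (∀ i i', i < i' → i' ≤ N → I i < I i') →
      (∫⁻ x, ((∑ jj ∈ Finset.range N,
          (⨆ t ∈ Set.Ico (I jj) (I (jj+1)) ∩ Set.Ioi (0:ℝ),
            ENNReal.ofReal ‖a t x - a (I jj) x‖) ^ r) ^ (1/r)) ^ p ∂μ) ^ (1/p)
        ≤ ENNReal.ofReal C) :
    ∀ᵐ x ∂μ, ∃ L : ℂ, Filter.Tendsto (fun t => a t x) Filter.atTop (nhds L) := by
  have key : ∀ k : ℕ, ∀ᵐ x ∂μ, ∃ m : ℕ, ∀ q : ℚ, (m:ℝ) ≤ q →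
      ‖a q x - a m x‖ ≤ 1 / ((k:ℝ) + 1) := by
    intro k
    have hδ : (0:ℝ) < 1 / ((k:ℝ) + 1) := by positivity
    choose f hf hfν using aux_bad μ.toFinite a hmeas _ hδ
    let I : ℕ → ℕ := fun j => f^[j] 1
    have hsucc : ∀ j, I (j+1) = f (I j) := fun j => Function.iterate_succ_apply' f j 1
    have hI : StrictMono I := strictMono_nat_of_lt_succ fun j => by rw [hsucc]; exact hf _
    have hI0 : ∀ i, 0 < I i := fun i => lt_of_lt_of_le Nat.one_pos (hI.monotone (Nat.zero_le i))
    have hBC : ∀ᵐ x ∂μ.toFinite, ∀ᶠ j in Filter.atTop,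
        x ∉ badset a (1 / ((k:ℝ) + 1)) (I j) (I (j+1)) := by
      apply ae_eventually_notMem
      refine ne_top_of_le_ne_top (b := ∑' j : ℕ, (2⁻¹ : ℝ≥0∞) ^ j) (by simp [ENNReal.tsum_geometric])
        (ENNReal.tsum_le_tsum fun j => ?_)
      rw [hsucc]
      exact (hfν _).trans (pow_le_pow_of_le_one (by simp) (by simp) (hI.id_le j))
    have hBC' := (absolutelyContinuous_toFinite μ).ae_le hBC
    filter_upwards [hBC', aux_fin μ a hmeas p r hp hr C hosc I hI0 hI] with x h1 h2
    by_contra hcon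
    push Not at hcon
    have h3 := h2.eventually_lt_const (ENNReal.ofReal_pos.2 hδ)
    obtain ⟨j, hj1, hj2⟩ := (h1.and h3).exists
    exact hj1 ⟨hcon (I j), hj2.le⟩
  filter_upwards [hcont, ae_all_iff.2 key] with x h1 h2
  exact aux_det (fun t => a t x) h1 h2
end

section
/- (Rademacher–Menshov inequality.) Let j_0, m ∈ ℕ with j_0 < 2^m and let (a_k : k ∈ ℕ) be a sequence of complex numbers. Then for every J ∈ {1, …, 2^m} and every I ∈ 𝔖_J([j_0, 2^m] ∩ ℕ): O^2_{I,J}(a_j : j_0 ≤ j ≤ 2^m) ≤ V^2(a_j : j_0 ≤ j ≤ 2^m) ≤ √2 · ∑_{i=0}^{m} (∑_{j=0}^{2^{m−i}−1} |∑_{k ∈ U_j^i, U_j^i ⊆ [j_0, 2^m)} (a_{k+1} − a_k)|^2)^{1/2}, where U_j^i := [j·2^i, (j+1)·2^i) ∩ ℕ and the inner sum over k is taken (and nonzero) only when U_j^i ⊆ [j_0, 2^m). -/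
open MeasureTheory ENNReal

/-- The `r`-variation seminorm `V^r(a_t : t ∈ S)` over an index set `S ⊆ ℕ`. -/
noncomputable def varNN (r : ℝ) (S : Set ℕ) (a : ℕ → ℂ) : ℝ≥0∞ :=
  ⨆ (J : ℕ) (_ : 0 < J) (t : ℕ → ℕ) (_ : ∀ i, i ≤ J → t i ∈ S)
    (_ : ∀ i i', i < i' → i' ≤ J → t i < t i'),
    (∑ j ∈ Finset.range J, ENNReal.ofReal ‖a (t (j+1)) - a (t j)‖ ^ r) ^ (1/r)

noncomputable def RMd (a : ℕ → ℂ) (k : ℕ) : ℝ := ‖a (k+1) - a k‖ ^ 2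

noncomputable def RMF (m : ℕ) (a : ℕ → ℂ) (j0 i : ℕ) : ℝ :=
  ∑ jj ∈ Finset.range (2 ^ (m - i)),
    (if j0 ≤ jj * 2 ^ i ∧ (jj + 1) * 2 ^ i ≤ 2 ^ m then
      ‖a ((jj+1) * 2 ^ i) - a (jj * 2 ^ i)‖ ^ 2 else 0)

theorem RMd_nonneg (a : ℕ → ℂ) (k : ℕ) : 0 ≤ RMd a k := by unfold RMd; positivity

theorem RM_short (a : ℕ → ℂ) (x y : ℕ) (h : x ≤ y) (h' : y ≤ x + 1) :
    ‖a y - a x‖ ^ 2 ≤ ∑ k ∈ Finset.Ico x y, RMd a k := by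
  have : y = x ∨ y = x + 1 := by omega
  rcases this with rfl | rfl
  · simp
  · simp [RMd]

theorem RM_disj (d : ℕ → ℝ) (hd : ∀ k, 0 ≤ d k) (j0 : ℕ) (x y : ℕ → ℕ)
    (h0 : ∀ j, j0 ≤ x j) (h1 : ∀ j, x j ≤ y j) (h2 : ∀ j, y j ≤ x (j+1)) (N : ℕ) :
    ∑ j ∈ Finset.range N, ∑ k ∈ Finset.Ico (x j) (y j), d k
      ≤ ∑ k ∈ Finset.Ico j0 (x N), d k := by
  induction N with
  | zero => simpa using Finset.sum_nonneg (fun k _ => hd k)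
  | succ N ih =>
    rw [Finset.sum_range_succ, ← Finset.sum_Ico_consecutive d (h0 N) ((h1 N).trans (h2 N)),
      ← Finset.sum_Ico_consecutive d (h1 N) (h2 N)]
    have := Finset.sum_nonneg (s := Finset.Ico (y N) (x (N+1))) (fun k _ => hd k)
    linarith

theorem RM_F0 (m : ℕ) (a : ℕ → ℂ) (j0 X : ℕ) (hX : X ≤ 2 ^ m) :
    ∑ k ∈ Finset.Ico j0 X, RMd a k ≤ RMF m a j0 0 := by
  unfold RMF
  have : ∀ k ∈ Finset.Ico j0 X, RMd a k = (if j0 ≤ k * 2 ^ 0 ∧ (k + 1) * 2 ^ 0 ≤ 2 ^ m then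
      ‖a ((k+1) * 2 ^ 0) - a (k * 2 ^ 0)‖ ^ 2 else 0) := by
    intro k hk
    rw [Finset.mem_Ico] at hk
    rw [if_pos (by constructor <;> simp <;> omega)]
    simp [RMd]
  rw [Finset.sum_congr rfl this]
  apply Finset.sum_le_sum_of_subset_of_nonneg
  · intro k hk
    rw [Finset.mem_Ico] at hk
    simp; omega
  · intros; split_ifs <;> positivity

theorem RM_level0 (m : ℕ) (a : ℕ → ℂ) (j0 : ℕ) (x y : ℕ → ℕ)
    (h0 : ∀ j, j0 ≤ x j) (h1 : ∀ j, x j ≤ y j) (h2 : ∀ j, y j ≤ x (j+1))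
    (h3 : ∀ j, y j ≤ 2 ^ m) (N : ℕ) (b : ℕ → ℂ)
    (hb : ∀ j, ‖b j‖ ^ 2 ≤ 2 * ∑ k ∈ Finset.Ico (x j) (y j), RMd a k) :
    Real.sqrt (∑ j ∈ Finset.range N, ‖b j‖ ^ 2) ≤ Real.sqrt 2 * Real.sqrt (RMF m a j0 0) := by
  rw [← Real.sqrt_mul (by norm_num)]
  apply Real.sqrt_le_sqrt
  calc _ ≤ ∑ j ∈ Finset.range N, 2 * ∑ k ∈ Finset.Ico (x j) (y j), RMd a k :=
        Finset.sum_le_sum (fun j _ => hb j)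
    _ ≤ _ := by
      rw [← Finset.mul_sum]
      have := RM_disj (RMd a) (RMd_nonneg a) j0 x y h0 h1 h2 N
      have := RM_F0 m a j0 (x N) ((h1 N).trans (h3 N))
      linarith

theorem RM_mink (N : ℕ) (u v : ℕ → ℂ) :
    Real.sqrt (∑ j ∈ Finset.range N, ‖u j + v j‖ ^ 2) ≤
      Real.sqrt (∑ j ∈ Finset.range N, ‖u j‖ ^ 2) + Real.sqrt (∑ j ∈ Finset.range N, ‖v j‖ ^ 2) := by
  have := norm_add_le (WithLp.toLp 2 (fun j : Fin N => u j) : EuclideanSpace ℂ (Fin N))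
    (WithLp.toLp 2 (fun j : Fin N => v j))
  simp only [EuclideanSpace.norm_eq, PiLp.add_apply] at this
  simpa only [Finset.sum_range] using this

theorem RM_shift (m : ℕ) (a : ℕ → ℂ) (j0 i : ℕ) :
    RMF m (fun k => a (2 * k)) ((j0 + 1) / 2) i = RMF (m+1) a j0 (i+1) := by
  unfold RMF
  rw [Nat.add_sub_add_right]
  apply Finset.sum_congr rfl
  intro jj _
  have e1 : jj * 2 ^ (i+1) = 2 * (jj * 2 ^ i) := by ring
  have e2 : (jj + 1) * 2 ^ (i+1) = 2 * ((jj + 1) * 2 ^ i) := by ring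
  have e3 : 2 ^ (m+1) = 2 * 2 ^ m := by ring
  rw [e1, e2, e3]
  refine if_congr ?_ rfl rfl
  generalize jj * 2 ^ i = p
  generalize (jj + 1) * 2 ^ i = q
  generalize 2 ^ m = r
  omega

theorem RM_main (m : ℕ) : ∀ (a : ℕ → ℂ) (j0 : ℕ) (x y : ℕ → ℕ)
    (_ : ∀ j, j0 ≤ x j) (_ : ∀ j, x j ≤ y j) (_ : ∀ j, y j ≤ x (j+1))
    (_ : ∀ j, y j ≤ 2 ^ m) (N : ℕ),
    Real.sqrt (∑ j ∈ Finset.range N, ‖a (y j) - a (x j)‖ ^ 2) ≤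
      Real.sqrt 2 * ∑ i ∈ Finset.range (m+1), Real.sqrt (RMF m a j0 i) := by
  induction m with
  | zero =>
    intro a j0 x y h0 h1 h2 h3 N
    rw [Finset.sum_range_one]
    refine RM_level0 0 a j0 x y h0 h1 h2 h3 N (fun j => a (y j) - a (x j)) ?_
    intro j
    have := RM_short a (x j) (y j) (h1 j) (by have := h3 j; simp at this; omega)
    have := Finset.sum_nonneg (s := Finset.Ico (x j) (y j)) (fun k _ => RMd_nonneg a k)
    show ‖a (y j) - a (x j)‖ ^ 2 ≤ _
    linarith
  | succ m ih =>
    intro a j0 x y h0 h1 h2 h3 N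
    have h3' : ∀ j, y j ≤ 2 * 2 ^ m := fun j => by have := h3 j; rw [pow_succ] at this; omega
    have key := ih (fun k => a (2 * k)) ((j0+1)/2) (fun j => (x j + 1)/2)
      (fun j => max ((x j + 1)/2) (y j / 2))
      (fun j => by have := h0 j; show _ ≤ (x j + 1)/2; omega)
      (fun j => le_max_left _ _)
      (fun j => by
        have := h1 j; have := h2 j
        show max ((x j + 1)/2) (y j / 2) ≤ (x (j+1) + 1)/2
        omega)
      (fun j => by
        have := h1 j; have := h3' j
        show max ((x j + 1)/2) (y j / 2) ≤ 2 ^ m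
        generalize 2 ^ m = r at *
        omega) N
    simp only [RM_shift] at key
    rw [Finset.sum_range_succ', mul_add]
    let b : ℕ → ℂ := fun j => (a (y j) - a (2 * max ((x j + 1)/2) (y j / 2)))
      + (a (2 * ((x j + 1)/2)) - a (x j))
    have hb := RM_level0 (m+1) a j0 x y h0 h1 h2 h3 N b (by
      intro j
      rcases (h1 j).eq_or_lt with h | h
      · have : max ((x j + 1)/2) (y j / 2) = (x j + 1)/2 := by omega
        simp only [b, this]
        simp [h]
      · have hm : max ((x j + 1)/2) (y j / 2) = y j / 2 := by omega
        simp only [b, hm]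
        have l1 : x j ≤ 2 * ((x j + 1)/2) := by omega
        have l2 : 2 * ((x j + 1)/2) ≤ 2 * (y j / 2) := by omega
        have l3 : 2 * (y j / 2) ≤ y j := by omega
        have s1 := RM_short a _ _ l1 (by omega)
        have s3 := RM_short a _ _ l3 (by omega)
        have s2 := Finset.sum_nonneg (s := Finset.Ico (2 * ((x j + 1)/2)) (2 * (y j / 2)))
          (fun k _ => RMd_nonneg a k)
        rw [← Finset.sum_Ico_consecutive (RMd a) l1 (l2.trans l3),
          ← Finset.sum_Ico_consecutive (RMd a) l2 l3]
        have t := norm_add_le (a (y j) - a (2 * (y j / 2))) (a (2 * ((x j + 1)/2)) - a (x j))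
        have t0 := norm_nonneg (a (y j) - a (2 * (y j / 2)) + (a (2 * ((x j + 1)/2)) - a (x j)))
        nlinarith [sq_nonneg (‖a (y j) - a (2 * (y j / 2))‖ - ‖a (2 * ((x j + 1)/2)) - a (x j)‖)])
    have hmk := RM_mink N (fun j => a (2 * max ((x j + 1)/2) (y j / 2)) - a (2 * ((x j + 1)/2))) b
    have : ∀ j, (fun j => a (2 * max ((x j + 1)/2) (y j / 2)) - a (2 * ((x j + 1)/2))) j + b j
        = a (y j) - a (x j) := by intro j; simp only [b]; ring
    simp only [this] at hmk
    exact hmk.trans (add_le_add key hb)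

theorem RM_conv {ι : Type*} (s : Finset ι) (f : ι → ℝ) (hf : ∀ i, 0 ≤ f i) :
    (∑ j ∈ s, ENNReal.ofReal (f j) ^ (2:ℝ)) ^ ((1:ℝ)/2) =
      ENNReal.ofReal (Real.sqrt (∑ j ∈ s, f j ^ 2)) := by
  have : ∀ j ∈ s, ENNReal.ofReal (f j) ^ (2:ℝ) = ENNReal.ofReal (f j ^ 2) := by
    intro j _
    rw [ENNReal.ofReal_rpow_of_nonneg (hf j) (by norm_num)]
    norm_num
  rw [Finset.sum_congr rfl this, ← ENNReal.ofReal_sum_of_nonneg (fun i _ => sq_nonneg _),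
    ENNReal.ofReal_rpow_of_nonneg (Finset.sum_nonneg (fun i _ => sq_nonneg _)) (by norm_num),
    Real.sqrt_eq_rpow]

/-- there is a chain in `S` ending at `n` with square sum at least `s` -/
def RMP (S : Set ℕ) (a : ℕ → ℂ) (n : ℕ) (s : ℝ≥0∞) : Prop :=
  ∃ (J : ℕ) (t : ℕ → ℕ), (∀ i, i ≤ J → t i ∈ S) ∧ (∀ i i', i < i' → i' ≤ J → t i < t i') ∧
    t J = n ∧ s ≤ ∑ j ∈ Finset.range J, ENNReal.ofReal ‖a (t (j+1)) - a (t j)‖ ^ (2:ℝ)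

theorem RMP_step (S : Set ℕ) (a : ℕ → ℂ) (n n' : ℕ) (s : ℝ≥0∞) (h : RMP S a n s) (hn : n ≤ n')
    (hS : n' ∈ S) : RMP S a n' (s + ENNReal.ofReal ‖a n' - a n‖ ^ (2:ℝ)) := by
  rcases hn.eq_or_lt with rfl | hlt
  · simpa using h
  obtain ⟨J, t, h1, h2, h3, h4⟩ := h
  refine ⟨J+1, fun i => if i ≤ J then t i else n', ?_, ?_, ?_, ?_⟩
  · intro i _
    dsimp only
    split_ifs with h
    · exact h1 i h
    · exact hS
  · intro i i' hi hi'
    dsimp only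
    rw [if_pos (by omega : i ≤ J)]
    split_ifs with h
    · exact h2 i i' hi h
    · rcases (show i ≤ J by omega).eq_or_lt with rfl | hh
      · omega
      · have := h2 i J hh le_rfl
        omega
  · simp
  · rw [Finset.sum_range_succ]
    refine add_le_add (h4.trans (le_of_eq ?_)) (by simp [h3])
    apply Finset.sum_congr rfl
    intro j hj
    rw [Finset.mem_range] at hj
    dsimp only
    rw [if_pos (by omega : j ≤ J), if_pos (by omega : j + 1 ≤ J)]

theorem RMP_var (S : Set ℕ) (a : ℕ → ℂ) (n : ℕ) (s : ℝ≥0∞) (h : RMP S a n s) :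
    s ^ ((1:ℝ)/2) ≤ varNN 2 S a := by
  obtain ⟨J, t, h1, h2, h3, h4⟩ := h
  rcases Nat.eq_zero_or_pos J with rfl | hJ
  · have : s = 0 := by simpa using h4
    simp [this]
  · refine (ENNReal.rpow_le_rpow h4 (by norm_num)).trans ?_
    unfold varNN
    exact le_iSup_of_le J (le_iSup_of_le hJ (le_iSup_of_le t (le_iSup_of_le h1
      (le_iSup_of_le h2 le_rfl))))

/-- The Rademacher–Menshov inequality for oscillations, (2.9) of
Mirek–Słomian–Szarek, with `U_j^i = [j2^i, (j+1)2^i)`. -/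
theorem stmt17 (j0 m : ℕ) (hj0 : j0 < 2 ^ m) (a : ℕ → ℂ)
    (J : ℕ) (hJ1 : 1 ≤ J) (hJ2 : J ≤ 2 ^ m)
    (I : ℕ → ℕ) (hImem : ∀ i, i ≤ J → I i ∈ Set.Icc j0 (2 ^ m))
    (hImono : ∀ i i', i < i' → i' ≤ J → I i < I i') :
    (∑ jj ∈ Finset.range J,
        (⨆ t ∈ Set.Ico (I jj) (I (jj+1)) ∩ Set.Icc j0 (2 ^ m),
          ENNReal.ofReal ‖a t - a (I jj)‖) ^ (2:ℝ)) ^ ((1:ℝ)/2)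
      ≤ varNN 2 (Set.Icc j0 (2 ^ m)) a ∧
    varNN 2 (Set.Icc j0 (2 ^ m)) a
      ≤ ENNReal.ofReal (Real.sqrt 2) *
        ∑ i ∈ Finset.range (m + 1),
          (∑ jj ∈ Finset.range (2 ^ (m - i)),
            (if j0 ≤ jj * 2 ^ i ∧ (jj + 1) * 2 ^ i ≤ 2 ^ m then
              ENNReal.ofReal
                ‖∑ k ∈ Finset.Ico (jj * 2 ^ i) ((jj + 1) * 2 ^ i), (a (k+1) - a k)‖ ^ (2:ℝ)
            else 0)) ^ ((1:ℝ)/2) := by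
  constructor
  · have main : ∀ N, N ≤ J → RMP (Set.Icc j0 (2 ^ m)) a (I N) (∑ jj ∈ Finset.range N,
        (⨆ t ∈ Set.Ico (I jj) (I (jj+1)) ∩ Set.Icc j0 (2 ^ m),
          ENNReal.ofReal ‖a t - a (I jj)‖) ^ (2:ℝ)) := by
      intro N
      induction N with
      | zero =>
        intro _
        exact ⟨0, fun _ => I 0, fun _ _ => hImem 0 (by omega), fun i i' h h' => by omega, rfl,
          by simp⟩
      | succ N ih =>
        intro hN
        have hlt := hImono N (N+1) (by omega) hN
        have hmem := hImem N (by omega)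
        obtain ⟨n, hn, hmax⟩ := Set.exists_max_image
          (Set.Ico (I N) (I (N+1)) ∩ Set.Icc j0 (2 ^ m))
          (fun t => ENNReal.ofReal ‖a t - a (I N)‖)
          ((Set.finite_Ico _ _).inter_of_left _) ⟨I N, ⟨le_rfl, hlt⟩, hmem⟩
        have p1 := RMP_step _ a _ n _ (ih (by omega)) hn.1.1 hn.2
        have p2 := RMP_step _ a _ (I (N+1)) _ p1 hn.1.2.le (hImem _ hN)
        obtain ⟨K, t, q1, q2, q3, q4⟩ := p2
        refine ⟨K, t, q1, q2, q3, le_trans ?_ q4⟩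
        rw [Finset.sum_range_succ]
        refine le_trans (add_le_add le_rfl ?_) le_self_add
        exact ENNReal.rpow_le_rpow (iSup₂_le hmax) (by norm_num)
    exact RMP_var _ a _ _ (main J le_rfl)
  · have hR : ENNReal.ofReal (Real.sqrt 2) *
        ∑ i ∈ Finset.range (m + 1),
          (∑ jj ∈ Finset.range (2 ^ (m - i)),
            (if j0 ≤ jj * 2 ^ i ∧ (jj + 1) * 2 ^ i ≤ 2 ^ m then
              ENNReal.ofReal
                ‖∑ k ∈ Finset.Ico (jj * 2 ^ i) ((jj + 1) * 2 ^ i), (a (k+1) - a k)‖ ^ (2:ℝ)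
            else 0)) ^ ((1:ℝ)/2) =
        ENNReal.ofReal (Real.sqrt 2 * ∑ i ∈ Finset.range (m+1), Real.sqrt (RMF m a j0 i)) := by
      rw [ENNReal.ofReal_mul (Real.sqrt_nonneg _),
        ENNReal.ofReal_sum_of_nonneg (fun i _ => Real.sqrt_nonneg _)]
      congr 1
      apply Finset.sum_congr rfl
      intro i _
      have := RM_conv (Finset.range (2 ^ (m - i)))
        (fun jj => if j0 ≤ jj * 2 ^ i ∧ (jj + 1) * 2 ^ i ≤ 2 ^ m then
          ‖a ((jj+1) * 2 ^ i) - a (jj * 2 ^ i)‖ else 0)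
        (fun jj => by split_ifs <;> positivity)
      unfold RMF
      convert this using 3
      · rename_i jj _
        split_ifs
        · rw [Finset.sum_Ico_sub a (Nat.mul_le_mul_right _ (Nat.le_succ jj))]
        · simp
      · apply Finset.sum_congr rfl
        intro jj _
        split_ifs <;> simp
    rw [hR]
    unfold varNN
    refine iSup_le fun K => iSup_le fun hK => iSup_le fun t => iSup_le fun ht => iSup_le fun hm => ?_
    rw [RM_conv _ _ (fun j => norm_nonneg _)]
    apply ENNReal.ofReal_le_ofReal
    have hmono : ∀ i i', i ≤ i' → i' ≤ K → t i ≤ t i' := by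
      intro i i' h h'
      rcases h.eq_or_lt with rfl | h
      · exact le_rfl
      · exact (hm i i' h h').le
    have := RM_main m a j0 (fun j => t (min j K)) (fun j => t (min (j+1) K))
      (fun j => (ht _ (min_le_right _ _)).1)
      (fun j => hmono _ _ (by omega) (min_le_right _ _))
      (fun j => le_rfl)
      (fun j => (ht _ (min_le_right _ _)).2) K
    refine le_trans (le_of_eq ?_) this
    congr 1
    apply Finset.sum_congr rfl
    intro j hj
    rw [Finset.mem_range] at hj
    rw [min_eq_left (by omega : j ≤ K), min_eq_left (by omega : j + 1 ≤ K)]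
end
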